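/- arXiv:1801.04024 — 2 statements merged into one kernel-verified Lean document; each statement's English description precedes it below -/
import Mathlib

section
/- A countable discrete group G is strongly amenable if and only if no quotient of G (i.e., no group G/N for N a normal subgroup of G) is ICC. -/
/-- A continuous action of `G` on a topological space `X` is proximal if for all `x, y ∈ X`
the closure of `{(g • x, g • y) : g ∈ G}` in `X × X` meets the diagonal. -/
def IsProximalAction (G X : Type*) [Group G] [MulAction G X] [TopologicalSpace X] : Prop :=
  ∀ x y : X, ∃ z : X, (z, z) ∈ closure {p : X × X | ∃ g : G, p = (g • x, g • y)}

/-- A group `G` is strongly amenable if every proximal continuous action of `G` on a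
nonempty compact Hausdorff space has a fixed point. -/
def IsStronglyAmenable (G : Type*) [Group G] : Prop :=
  ∀ (X : Type) [TopologicalSpace X] [CompactSpace X] [T2Space X] [Nonempty X]
    [MulAction G X] [ContinuousConstSMul G X],
    IsProximalAction G X → ∃ z : X, ∀ g : G, g • z = z

/-- A group is ICC if it is nontrivial and every non-identity element has an infinite
conjugacy class. -/
def IsICC (G : Type*) [Group G] : Prop :=
  Nontrivial G ∧ ∀ g : G, g ≠ 1 → {h : G | IsConj g h}.Infinite

open Filter Pointwise

section Generic

variable {G : Type*} [Group G]

theorem IsICC.infinite (hG : IsICC G) : Infinite G := by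
  obtain ⟨_, h⟩ := hG
  obtain ⟨g, hg⟩ := exists_ne (1 : G)
  exact Set.infinite_univ_iff.1 ((h g hg).mono (Set.subset_univ _))

theorem IsICC.not_finiteIndex_centralizer (hG : IsICC G) {g : G} (hg : g ≠ 1) :
    ¬ (Subgroup.centralizer {g}).FiniteIndex := by
  intro hfin
  refine hG.2 g hg ((Set.finite_range
    fun q : G ⧸ Subgroup.centralizer {g} ↦ q.out * g * q.out⁻¹).subset ?_)
  rintro h hh
  obtain ⟨c, rfl⟩ := isConj_iff.1 hh
  refine ⟨QuotientGroup.mk c, ?_⟩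
  obtain ⟨k, hk⟩ := QuotientGroup.mk_out_eq_mul (Subgroup.centralizer {g}) c
  have hkg : g * k = k * g := Subgroup.mem_centralizer_iff.1 k.2 g rfl
  simp only [hk, mul_inv_rev]
  calc c * k * g * ((k : G)⁻¹ * c⁻¹) = c * (k * g) * (k : G)⁻¹ * c⁻¹ := by group
    _ = c * g * c⁻¹ := by rw [← hkg]; group

theorem IsICC.exists_forall_mul_ne (hG : IsICC G) {ι : Type*} [Finite ι] (m k : ι → G)
    (hm : ∀ i, m i ≠ 1) : ∃ w : G, ∀ i, w * m i ≠ k i * w := by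
  classical
  cases nonempty_fintype ι
  by_contra! hcon
  choose i hi using hcon
  let S : Finset ι := Finset.univ.filter fun j ↦ ∃ w, w * m j = k j * w
  have hS : ∀ j, ∃ w, j ∈ S → w * m j = k j * w := by
    intro j
    by_cases hj : j ∈ S
    · obtain ⟨w, hw⟩ := (Finset.mem_filter.1 hj).2
      exact ⟨w, fun _ ↦ hw⟩
    · exact ⟨1, fun h ↦ absurd h hj⟩
  choose w hw using hS
  have hcov : ⋃ j ∈ S, w j • (Subgroup.centralizer {m j} : Set G) = Set.univ := by
    refine Set.eq_univ_of_forall fun v ↦ ?_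
    have hv : i v ∈ S := Finset.mem_filter.2 ⟨Finset.mem_univ _, v, hi v⟩
    refine Set.mem_iUnion₂.2 ⟨i v, hv, Set.mem_smul_set_iff_inv_smul_mem.2 ?_⟩
    rw [SetLike.mem_coe, Subgroup.mem_centralizer_iff]
    rintro _ rfl
    have h1 := hi v
    have h2 := hw _ hv
    have h3 : v * m (i v) = w (i v) * m (i v) * (w (i v))⁻¹ * v := by
      rw [h1, h2]; group
    rw [smul_eq_mul, mul_assoc, h3]; group
  obtain ⟨j, -, hj⟩ := Subgroup.exists_finiteIndex_of_leftCoset_cover hcov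
  exact hG.not_finiteIndex_centralizer (hm j) hj

/-- A set is small if each of its intersections with a nontrivial right translate of itself
lies in a coset of the centralizer of a nontrivial element. -/
def IsSmall (S : Set G) : Prop :=
  ∀ z : G, z ≠ 1 → ∃ m k : G, m ≠ 1 ∧ ∀ w ∈ S, w * z ∈ S → w * m = k * w

/-- The filter of sets whose complement is covered by finitely many small sets. -/
def genericFilter (G : Type*) [Group G] : Filter G := generate {A | IsSmall Aᶜ}

theorem IsICC.genericFilter_neBot (hG : IsICC G) : (genericFilter G).NeBot := by
  have := hG.infinite
  refine generate_neBot_iff.2 fun t ht htf ↦ ?_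
  have : Fintype t := htf.fintype
  let y := Infinite.natEmbedding G
  let ι := {p : t × Fin (Fintype.card t + 1) × Fin (Fintype.card t + 1) // p.2.1 ≠ p.2.2}
  have key : ∀ p : ι, ∃ m k : G, m ≠ 1 ∧ ∀ w, w * y p.1.2.1 ∉ p.1.1.1 →
      w * y p.1.2.2 ∉ p.1.1.1 → w * m = k * w := by
    rintro ⟨⟨A, i, j⟩, hij⟩
    have hne : (y i)⁻¹ * y j ≠ 1 := by
      intro h
      exact hij (Fin.ext (y.injective (inv_mul_eq_one.1 h)))
    obtain ⟨m, k, hm, h⟩ := ht A.2 _ hne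
    refine ⟨y i * m * (y i)⁻¹, k, fun h1 ↦ hm ?_, fun w h1 h2 ↦ ?_⟩
    · simpa using h1
    · have := h (w * y i) h1 (by simpa [mul_assoc] using h2)
      calc w * (y i * m * (y i)⁻¹) = (w * y i * m) * (y i)⁻¹ := by group
        _ = k * w := by rw [this]; group
  choose m k hm h using key
  obtain ⟨w, hw⟩ := hG.exists_forall_mul_ne m k hm
  by_contra hemp
  have hA : ∀ i : Fin (Fintype.card t + 1), ∃ A : t, w * y i ∉ A.1 := by
    intro i
    by_contra! hc
    exact hemp ⟨w * y i, fun A hA ↦ hc ⟨A, hA⟩⟩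
  choose A hA using hA
  obtain ⟨i, j, hij, heq⟩ := Fintype.exists_ne_map_eq_of_card_lt A (by simp)
  exact hw ⟨(A i, i, j), hij⟩ (h _ w (hA i) (by simpa [heq] using hA j))

theorem IsSmall.eventually {p : G → Prop} (h : IsSmall {w | ¬ p w}) :
    ∀ᶠ w in genericFilter G, p w :=
  GenerateSets.basic h

theorem eventually_generic_of_conj {p : G → Prop}
    (h : ∀ z : G, z ≠ 1 → ∃ m k : G, (m ≠ 1 ∨ k ≠ 1) ∧
      ∀ w, ¬ p w → ¬ p (w * z) → w * m = k * w) :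
    ∀ᶠ w in genericFilter G, p w := by
  refine IsSmall.eventually fun z hz ↦ ?_
  obtain ⟨m, k, hmk, hw⟩ := h z hz
  by_cases hm : m = 1
  · refine ⟨z, 1, hz, fun w h1 h2 ↦ absurd (hw w h1 h2) fun h3 ↦ ?_⟩
    subst hm
    exact hmk.elim (· rfl) (· (by simpa using h3))
  · exact ⟨m, k, hm, fun w h1 h2 ↦ hw w h1 h2⟩

theorem eventually_generic_ne (k : G) : ∀ᶠ w in genericFilter G, w ≠ k := by
  refine eventually_generic_of_conj fun z hz ↦ ⟨z, 1, .inl hz, fun w h1 h2 ↦ ?_⟩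
  rw [not_not] at h1 h2
  rw [one_mul, h2, h1]

theorem eventually_generic_conj {m k : G} (hmk : m ≠ 1 ∨ k ≠ 1) :
    ∀ᶠ w in genericFilter G, w * m ≠ k * w :=
  eventually_generic_of_conj fun _ _ ↦ ⟨m, k, hmk, fun _ h _ ↦ not_not.1 h⟩

theorem eventually_generic_mul_mul (a b : G) : ∀ᶠ w in genericFilter G, w * a * w ≠ b := by
  refine eventually_generic_of_conj fun z hz ↦
    ⟨z⁻¹, a⁻¹ * z * a, .inl (inv_ne_one.2 hz), fun w h1 h2 ↦ ?_⟩
  rw [not_not] at h1 h2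
  rw [← h1] at h2
  have h3 : z * a * w * z = a * w := by
    apply mul_left_cancel (a := w)
    simpa [mul_assoc] using h2
  calc w * z⁻¹ = a⁻¹ * (a * w) * z⁻¹ := by group
    _ = _ := by rw [← h3]; group

theorem eventually_generic_mul_ne_mul_conj (a b c : G) :
    ∀ᶠ w in genericFilter G, w * a ≠ b * (w⁻¹ * c * w) := by
  refine eventually_generic_of_conj fun z hz ↦
    ⟨z * a * z⁻¹ * a⁻¹, b * z⁻¹ * b⁻¹, .inr ?_, fun w h1 h2 ↦ ?_⟩
  · rwa [ne_eq, conj_eq_one_iff, inv_eq_one]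
  rw [not_not] at h1 h2
  have h3 : w⁻¹ * c * w = b⁻¹ * (w * a) := by rw [h1]; group
  have h4 : w * z * a = b * (z⁻¹ * (w⁻¹ * c * w) * z) := by rw [h2]; group
  calc w * (z * a * z⁻¹ * a⁻¹) = (w * z * a) * z⁻¹ * a⁻¹ := by group
    _ = _ := by rw [h4, h3]; group

theorem eventually_generic_inv_mul_ne_mul_conj (a b c : G) :
    ∀ᶠ w in genericFilter G, w⁻¹ * a ≠ b * (w⁻¹ * c * w) := by
  refine eventually_generic_of_conj fun z hz ↦
    ⟨z * b * z⁻¹ * b⁻¹, a * z⁻¹ * a⁻¹, .inr ?_, fun w h1 h2 ↦ ?_⟩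
  · rwa [ne_eq, conj_eq_one_iff, inv_eq_one]
  rw [not_not] at h1 h2
  have h3 : w⁻¹ * c * w = b⁻¹ * (w⁻¹ * a) := by rw [h1]; group
  have h4 : z⁻¹ * (w⁻¹ * a) = b * (z⁻¹ * (w⁻¹ * c * w) * z) := by
    rw [← mul_assoc, ← mul_inv_rev, h2]; group
  rw [h3] at h4
  calc w * (z * b * z⁻¹ * b⁻¹)
      = w * z * (b * (z⁻¹ * (b⁻¹ * (w⁻¹ * a)) * z)) * z⁻¹ * a⁻¹ * w := by group
    _ = _ := by rw [← h4]; group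

end Generic

section Shapes

variable {G : Type*} [Group G]

/-- No element of `S` is a left translate of an element of `T` by a nontrivial element of `F`. -/
def IsSeparatedPair (F S T : Set G) : Prop :=
  ∀ f ∈ F, f ≠ 1 → ∀ s ∈ S, ∀ t ∈ T, s ≠ f * t

theorem IsSeparatedPair.symm {F S T : Set G} (hF : ∀ f ∈ F, f⁻¹ ∈ F)
    (h : IsSeparatedPair F S T) : IsSeparatedPair F T S := by
  rintro f hf hf1 t ht s hs rfl
  exact h f⁻¹ (hF f hf) (inv_ne_one.2 hf1) s hs _ ht (by group)

theorem IsSeparatedPair.union_left {F S S' T : Set G} (h : IsSeparatedPair F S T)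
    (h' : IsSeparatedPair F S' T) : IsSeparatedPair F (S ∪ S') T :=
  fun f hf hf1 s hs ↦ hs.elim (h f hf hf1 s) (h' f hf hf1 s)

theorem IsSeparatedPair.union {F S T : Set G} (hF : ∀ f ∈ F, f⁻¹ ∈ F)
    (hS : IsSeparatedPair F S S) (hT : IsSeparatedPair F T T) (hST : IsSeparatedPair F S T) :
    IsSeparatedPair F (S ∪ T) (S ∪ T) :=
  ((hS.union_left (hST.symm hF)).symm hF).union_left ((hST.union_left hT).symm hF)

theorem eventually_isSeparatedPair_image {α β : Type*} {l : Filter G} {F : Set G} {S : Set α}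
    {T : Set β} (hF : F.Finite) (hS : S.Finite) (hT : T.Finite) {p : G → α → G} {q : G → β → G}
    (h : ∀ f ∈ F, f ≠ 1 → ∀ s ∈ S, ∀ t ∈ T, ∀ᶠ w in l, p w s ≠ f * q w t) :
    ∀ᶠ w in l, IsSeparatedPair F (p w '' S) (q w '' T) := by
  have : ∀ᶠ w in l, ∀ f ∈ F, f ≠ 1 → ∀ s ∈ S, ∀ t ∈ T, p w s ≠ f * q w t := by
    refine (eventually_all_finite hF).2 fun f hf ↦ ?_
    by_cases hf1 : f = 1
    · exact Eventually.of_forall fun w h ↦ absurd hf1 h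
    · filter_upwards [(eventually_all_finite hS).2 fun s hs ↦
        (eventually_all_finite hT).2 (h f hf hf1 s hs)] with w hw _ using hw
  filter_upwards [this] with w hw
  rintro f hf hf1 _ ⟨s, hs, rfl⟩ _ ⟨t, ht, rfl⟩
  exact hw f hf hf1 s hs t ht

theorem eventually_isSeparatedPair_mul {F S : Set G} (hF : F.Finite) (hS : S.Finite) :
    ∀ᶠ w in genericFilter G, IsSeparatedPair F ((w * ·) '' S) ((w * ·) '' S) := by
  refine eventually_isSeparatedPair_image hF hS hS fun f _ hf1 a _ b _ ↦ ?_
  filter_upwards [eventually_generic_conj (m := a * b⁻¹) (.inr hf1)] with w hw h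
  exact hw (by rw [← mul_assoc, h]; group)

theorem eventually_isSeparatedPair_inv_mul {F S : Set G} (hF : F.Finite) (hS : S.Finite) :
    ∀ᶠ w in genericFilter G, IsSeparatedPair F ((w⁻¹ * ·) '' S) ((w⁻¹ * ·) '' S) := by
  refine eventually_isSeparatedPair_image hF hS hS fun f _ hf1 a _ b _ ↦ ?_
  filter_upwards [eventually_generic_conj (k := a * b⁻¹) (.inl hf1)] with w hw h
  refine hw ?_
  calc w * f = w * (f * (w⁻¹ * b)) * b⁻¹ * w := by group
    _ = _ := by rw [← h]; group

theorem eventually_isSeparatedPair_mul_inv_mul {F S T : Set G} (hF : F.Finite) (hS : S.Finite)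
    (hT : T.Finite) :
    ∀ᶠ w in genericFilter G, IsSeparatedPair F ((w * ·) '' S) ((w⁻¹ * ·) '' T) := by
  refine eventually_isSeparatedPair_image hF hS hT fun f _ hf1 a _ b _ ↦ ?_
  filter_upwards [eventually_generic_mul_mul f⁻¹ (b * a⁻¹)] with w hw h
  refine hw ?_
  calc w * f⁻¹ * w = w * f⁻¹ * (w * a) * a⁻¹ := by group
    _ = _ := by rw [h]; group

theorem IsICC.exists_separated_pair (hG : IsICC G) {F : Set G} (hF : F.Finite)
    (hFinv : ∀ f ∈ F, f⁻¹ ∈ F) :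
    ∃ u : G, u ∉ F ∧
      IsSeparatedPair F ((u * ·) '' F ∪ (u⁻¹ * ·) '' F) ((u * ·) '' F ∪ (u⁻¹ * ·) '' F) ∧
      ∀ f ∈ F, ∀ a ∈ (u * ·) '' F ∪ (u⁻¹ * ·) '' F, f * a ≠ 1 := by
  have := hG.genericFilter_neBot
  have h1 : ∀ᶠ u in genericFilter G, ∀ f ∈ F, u ≠ f :=
    (eventually_all_finite hF).2 fun f _ ↦ eventually_generic_ne f
  have h2 : ∀ᶠ u in genericFilter G, ∀ f ∈ F, ∀ g ∈ F, u ≠ f * g :=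
    (eventually_all_finite hF).2 fun f _ ↦ (eventually_all_finite hF).2 fun g _ ↦
      eventually_generic_ne _
  have h3 := eventually_isSeparatedPair_mul hF hF
  have h4 := eventually_isSeparatedPair_inv_mul hF hF
  have h5 := eventually_isSeparatedPair_mul_inv_mul hF hF hF
  obtain ⟨u, h1, h2, h3, h4, h5⟩ := (h1.and (h2.and (h3.and (h4.and h5)))).exists
  refine ⟨u, fun hu ↦ h1 u hu rfl, h3.union hFinv h4 h5, ?_⟩
  rintro f hf _ (⟨g, hg, rfl⟩ | ⟨g, hg, rfl⟩) h
  · exact h2 f⁻¹ (hFinv f hf) g⁻¹ (hFinv g hg) (by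
      rw [← mul_assoc, mul_eq_one_iff_eq_inv] at h; rw [← h]; group)
  · refine h2 g hg f hf ?_
    rw [← mul_assoc, mul_eq_one_iff_eq_inv, ← eq_inv_mul_iff_mul_eq] at h
    rw [← inv_inj, h]; group

theorem IsICC.exists_separated_cover (hG : IsICC G) {F A B R N : Set G} (hF : F.Finite)
    (hFinv : ∀ f ∈ F, f⁻¹ ∈ F) (hA : A.Finite) (hB : B.Finite) (hR : R.Finite) (hN : N.Finite)
    (hAsep : IsSeparatedPair F A A) (hA1 : ∀ f ∈ F, ∀ a ∈ A, f * a ≠ 1) :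
    ∃ v : G, v ∉ N ∧ ∃ E : Set G, E.Finite ∧ IsSeparatedPair F E E ∧ (∀ r ∈ R, v * r ∈ E) ∧
      (∀ a ∈ A, a * v ∈ E) ∧ (∀ b ∈ B, v⁻¹ * b ∈ E) ∧ ∀ f ∈ F, v⁻¹ * f * v ∈ E := by
  have := hG.genericFilter_neBot
  have h0 : ∀ᶠ u in genericFilter G, ∀ f ∈ N, u ≠ f :=
    (eventually_all_finite hN).2 fun f _ ↦ eventually_generic_ne f
  have h1 := eventually_isSeparatedPair_mul hF hR
  have h2 : ∀ᶠ v in genericFilter G, IsSeparatedPair F ((v * ·) '' R) ((· * v) '' A) := by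
    refine eventually_isSeparatedPair_image hF hR hA fun f hf hf1 x _ a ha ↦ ?_
    filter_upwards [eventually_generic_conj (m := x) (.inr (hA1 f hf a ha))] with v hv h
    exact hv (by rw [h, mul_assoc])
  have h3 := eventually_isSeparatedPair_mul_inv_mul hF hR hB
  have h4 : ∀ᶠ v in genericFilter G,
      IsSeparatedPair F ((v * ·) '' R) ((fun f ↦ v⁻¹ * f * v) '' F) :=
    eventually_isSeparatedPair_image hF hR hF fun f _ hf1 a _ b _ ↦
      eventually_generic_mul_ne_mul_conj a f b
  have h5 : ∀ᶠ v in genericFilter G, IsSeparatedPair F ((· * v) '' A) ((v⁻¹ * ·) '' B) := by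
    refine eventually_isSeparatedPair_image hF hA hB fun f _ hf1 a _ b _ ↦ ?_
    filter_upwards [eventually_generic_mul_mul (f⁻¹ * a) b] with v hv h
    exact hv (by rw [mul_assoc, mul_assoc f⁻¹, h]; group)
  have h6 : ∀ᶠ v in genericFilter G,
      IsSeparatedPair F ((· * v) '' A) ((fun f ↦ v⁻¹ * f * v) '' F) := by
    refine eventually_isSeparatedPair_image hF hA hF fun f _ hf1 a _ b _ ↦ ?_
    filter_upwards [eventually_generic_ne (b * a⁻¹ * f)] with v hv h
    rw [← mul_assoc, mul_left_inj] at h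
    exact hv (by rw [h]; group)
  have h7 := eventually_isSeparatedPair_inv_mul hF hB
  have h8 : ∀ᶠ v in genericFilter G,
      IsSeparatedPair F ((v⁻¹ * ·) '' B) ((fun f ↦ v⁻¹ * f * v) '' F) :=
    eventually_isSeparatedPair_image hF hB hF fun f _ hf1 a _ b _ ↦
      eventually_generic_inv_mul_ne_mul_conj a f b
  have h9 : ∀ᶠ v in genericFilter G,
      IsSeparatedPair F ((fun f ↦ v⁻¹ * f * v) '' F) ((fun f ↦ v⁻¹ * f * v) '' F) := by
    refine eventually_isSeparatedPair_image hF hF hF fun f _ hf1 a _ b _ ↦ ?_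
    filter_upwards [eventually_generic_conj (k := a * b⁻¹) (.inl hf1)] with v hv h
    rw [mul_assoc v⁻¹ b v, ← mul_assoc, ← mul_assoc, mul_left_inj, ← inv_mul_eq_iff_eq_mul] at h
    refine hv ?_
    rw [← h]; group
  obtain ⟨v, h0, h1, h2, h3, h4, h5, h6, h7, h8, h9⟩ := (h0.and (h1.and (h2.and (h3.and (h4.and
    (h5.and (h6.and (h7.and (h8.and h9))))))))).exists
  refine ⟨v, fun hv ↦ h0 v hv rfl, (v * ·) '' R ∪ ((· * v) '' A ∪ ((v⁻¹ * ·) '' B ∪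
    (fun f ↦ v⁻¹ * f * v) '' F)), (hR.image _).union ((hA.image _).union ((hB.image _).union
    (hF.image _))), h1.union hFinv ?_ ?_, fun r hr ↦ .inl ⟨r, hr, rfl⟩,
    fun r hr ↦ .inr (.inl ⟨r, hr, rfl⟩), fun r hr ↦ .inr (.inr (.inl ⟨r, hr, rfl⟩)),
    fun r hr ↦ .inr (.inr (.inr ⟨r, hr, rfl⟩))⟩
  · have hAv : IsSeparatedPair F ((· * v) '' A) ((· * v) '' A) := by
      rintro f hf hf1 _ ⟨a, ha, rfl⟩ _ ⟨b, hb, rfl⟩ h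
      exact hAsep f hf hf1 a ha b hb (by rwa [← mul_assoc, mul_left_inj] at h)
    refine hAv.union hFinv (h7.union hFinv h9 h8) ?_
    exact ((h5.symm hFinv).union_left (h6.symm hFinv)).symm hFinv
  · exact ((h2.symm hFinv).union_left
      ((h3.symm hFinv).union_left (h4.symm hFinv))).symm hFinv

theorem IsICC.exists_separated_hitting (hG : IsICC G) {F : Set G} (hF : F.Finite)
    (hFinv : ∀ f ∈ F, f⁻¹ ∈ F) :
    ∃ T E : Set G, T.Finite ∧ E.Finite ∧ 1 ∈ T ∧ IsSeparatedPair F T T ∧ IsSeparatedPair F E E ∧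
      ∀ r ∈ T⁻¹ * F * T, ∃ s ∈ T, s * r ∈ E := by
  obtain ⟨u, huF, hA, hA1⟩ := hG.exists_separated_pair hF hFinv
  obtain ⟨v, hv, E, hE, hEsep, hR, hA, hB, hC⟩ := hG.exists_separated_cover
    (B := F ∪ (· * u) '' F) (R := {1, u⁻¹} * F * {1, u}) (N := F ∪ (· * u) '' F) hF hFinv
    ((hF.image _).union (hF.image _)) (hF.union (hF.image _))
    (((Set.toFinite _).mul hF).mul (Set.toFinite _)) (hF.union (hF.image _)) hA hA1
  have hvF : v ∉ F := fun h ↦ hv (.inl h)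
  have hvu : ∀ f ∈ F, v ≠ f * u := fun f hf h ↦ hv (.inr ⟨f, hf, h.symm⟩)
  refine ⟨{1, u, v}, E, Set.toFinite _, hE, by simp, ?_, hEsep, ?_⟩
  · rintro f hf hf1 s hs t ht rfl
    have hfi := hFinv f hf
    have hfu : f⁻¹ * (f * u) = u := inv_mul_cancel_left f u
    simp only [Set.mem_insert_iff, Set.mem_singleton_iff] at hs ht
    rcases ht with rfl | rfl | rfl <;> rcases hs with hs | hs | hs
    · exact hf1 (by simpa using hs)
    · exact huF (by rwa [← hs, mul_one])
    · exact hvF (by rwa [← hs, mul_one])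
    · exact huF (by rwa [← inv_eq_of_mul_eq_one_right hs])
    · exact hf1 (by simpa using hs)
    · exact hvu f hf hs.symm
    · exact hvF (by rwa [← inv_eq_of_mul_eq_one_right hs])
    · exact hvu _ hfi (eq_inv_mul_of_mul_eq hs)
    · exact hf1 (by simpa using hs)
  · rintro _ ⟨_, ⟨a, ha, f, hf, rfl⟩, b, hb, rfl⟩
    have ha' : a = 1 ∨ a = u⁻¹ ∨ a = v⁻¹ := by
      simpa [inv_eq_iff_eq_inv] using ha
    simp only [Set.mem_insert_iff, Set.mem_singleton_iff] at hb
    have hlow : a ∈ ({1, u⁻¹} : Set G) → b ∈ ({1, u} : Set G) →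
        ∃ s ∈ ({1, u, v} : Set G), s * (a * f * b) ∈ E := fun ha hb ↦
      ⟨v, by simp, hR _ (Set.mul_mem_mul (Set.mul_mem_mul ha hf) hb)⟩
    rcases ha' with rfl | rfl | rfl <;> rcases hb with rfl | rfl | rfl
    · exact hlow (by simp) (by simp)
    · exact hlow (by simp) (by simp)
    · exact ⟨u, by simp, by simpa [mul_assoc] using hA _ (.inl ⟨f, hf, rfl⟩)⟩
    · exact hlow (by simp) (by simp)
    · exact hlow (by simp) (by simp)
    · exact ⟨1, by simp, by simpa [mul_assoc] using hA _ (.inr ⟨f, hf, rfl⟩)⟩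
    · exact ⟨1, by simp, by simpa [mul_assoc] using hB _ (.inl hf)⟩
    · exact ⟨1, by simp, by simpa [mul_assoc] using hB _ (.inr ⟨f, hf, rfl⟩)⟩
    · exact ⟨1, by simp, by simpa [mul_assoc] using hC f hf⟩

theorem IsICC.exists_shapes (hG : IsICC G) {F : Set G} (hF : F.Finite)
    (hFinv : ∀ f ∈ F, f⁻¹ ∈ F) :
    ∃ (T₁ T₂ : Set G) (h : G), T₁.Finite ∧ T₂.Finite ∧ 1 ∈ T₁ ∧
      IsSeparatedPair F T₁ T₁ ∧ IsSeparatedPair F T₂ T₂ ∧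
      (∀ r ∈ T₁⁻¹ * F * T₁, (∃ s ∈ T₁, s * r ∈ T₂) ∧ ∃ s ∈ T₁, s * r * h ∈ T₂) ∧
      ∀ q ∈ T₂⁻¹ * F * T₁, ∀ q' ∈ T₂⁻¹ * F * T₁, q = q' * h → q = 1 := by
  obtain ⟨T, E, hT, hE, h1T, hTsep, hEsep, hit⟩ := hG.exists_separated_hitting hF hFinv
  have := hG.genericFilter_neBot
  let L := E⁻¹ * F * T
  have hL : L.Finite := (hE.inv.mul hF).mul hT
  have h1 : ∀ᶠ h in genericFilter G, IsSeparatedPair F ((fun x ↦ x) '' E) ((· * h) '' E) := by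
    refine eventually_isSeparatedPair_image hF hE hE fun f _ _ a _ b _ ↦ ?_
    filter_upwards [eventually_generic_ne ((f * b)⁻¹ * a)] with h hh h'
    exact hh (by rw [h']; group)
  have h2 : ∀ᶠ h in genericFilter G, ∀ a ∈ L, ∀ b ∈ L, h ≠ b⁻¹ * a :=
    (eventually_all_finite hL).2 fun a _ ↦ (eventually_all_finite hL).2 fun b _ ↦
      eventually_generic_ne _
  have h3 : ∀ᶠ h in genericFilter G, ∀ a ∈ L, ∀ b ∈ L, h * a = b * h → a = 1 :=
    (eventually_all_finite hL).2 fun a _ ↦ (eventually_all_finite hL).2 fun b _ ↦ by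
      by_cases ha : a = 1
      · exact Eventually.of_forall fun _ _ ↦ ha
      · filter_upwards [eventually_generic_conj (k := b) (.inl ha)] with h hh h' using absurd h' hh
  have h4 : ∀ᶠ h in genericFilter G, ∀ a ∈ L, ∀ b ∈ L, h * b * h ≠ a :=
    (eventually_all_finite hL).2 fun a _ ↦ (eventually_all_finite hL).2 fun b _ ↦
      eventually_generic_mul_mul _ _
  obtain ⟨h, h1, h2, h3, h4⟩ := (h1.and (h2.and (h3.and h4))).exists
  rw [Set.image_id'] at h1
  have hq : ∀ q ∈ (E ∪ (· * h) '' E)⁻¹ * F * T, q ∈ L ∨ h * q ∈ L := by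
    rintro _ ⟨_, ⟨a, ha, f, hf, rfl⟩, b, hb, rfl⟩
    rcases ha with ha | ⟨e, he, hea⟩
    · exact .inl (Set.mul_mem_mul (Set.mul_mem_mul ha hf) hb)
    · refine .inr ?_
      have : h * (a * f * b) = e⁻¹ * f * b := by
        rw [← inv_inv a, ← hea]; group
      simp only [this]
      exact Set.mul_mem_mul (Set.mul_mem_mul (Set.inv_mem_inv.2 he) hf) hb
  refine ⟨T, E ∪ (· * h) '' E, h, hT, hE.union (hE.image _), h1T, hTsep,
    hEsep.union hFinv ?_ h1, fun r hr ↦ ?_, fun q hq1 q' hq2 heq ↦ ?_⟩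
  · rintro f hf hf1 _ ⟨a, ha, rfl⟩ _ ⟨b, hb, rfl⟩ h
    exact hEsep f hf hf1 a ha b hb (by rwa [← mul_assoc, mul_left_inj] at h)
  · obtain ⟨s, hs, hE⟩ := hit r hr
    exact ⟨⟨s, hs, .inl hE⟩, s, hs, .inr ⟨_, hE, rfl⟩⟩
  · rcases hq q hq1 with hq1 | hq1 <;> rcases hq q' hq2 with hq2 | hq2
    · exact absurd (by rw [heq]; group) (h2 _ hq1 _ hq2)
    · exact h3 _ hq1 _ hq2 (by rw [heq]; group)
    · exact absurd (by rw [heq]; group) (h4 _ hq1 _ hq2)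
    · exact absurd (by rw [heq]; group) (h2 _ hq1 _ hq2)

end Shapes

section Markers

variable {G : Type*} [Group G]

/-- A set `C` avoiding `B` whose points are pairwise `R`-separated, and such that every point
outside `B` is within `R` of `C`. -/
structure IsMaximalSeparated (R B C : Set G) : Prop where
  notMem : ∀ c ∈ C, c ∉ B
  sep : ∀ c ∈ C, ∀ r ∈ R, r * c ∈ C → r = 1
  cover : ∀ g, g ∈ B ∨ ∃ r ∈ R, r * g ∈ C

theorem IsMaximalSeparated.translate {R B C : Set G} (h : IsMaximalSeparated R B C) (g : G) :
    IsMaximalSeparated R {c | c * g ∈ B} {c | c * g ∈ C} where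
  notMem c hc := h.notMem _ hc
  sep c hc r hr hrc := h.sep _ hc r hr (by simpa [mul_assoc] using hrc)
  cover c := by simpa [mul_assoc] using h.cover (c * g)

theorem exists_isMaximalSeparated {R B C₀ : Set G} (hR : ∀ r ∈ R, r⁻¹ ∈ R) (h1R : 1 ∈ R)
    (hB : ∀ c ∈ C₀, c ∉ B) (hC : ∀ c ∈ C₀, ∀ r ∈ R, r * c ∈ C₀ → r = 1) :
    ∃ C, C₀ ⊆ C ∧ IsMaximalSeparated R B C := by
  obtain ⟨C, hsub, hmax⟩ := zorn_subset_nonempty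
    {C : Set G | (∀ c ∈ C, c ∉ B) ∧ ∀ c ∈ C, ∀ r ∈ R, r * c ∈ C → r = 1} (by
      intro 𝒞 h𝒞 hchain hne
      refine ⟨⋃₀ 𝒞, ⟨?_, ?_⟩, fun s hs ↦ Set.subset_sUnion_of_mem hs⟩
      · rintro c ⟨s, hs, hcs⟩
        exact (h𝒞 hs).1 c hcs
      · rintro c ⟨s, hs, hcs⟩ r hr ⟨t, ht, hct⟩
        rcases hchain.total hs ht with hst | hst
        · exact (h𝒞 ht).2 c (hst hcs) r hr hct
        · exact (h𝒞 hs).2 c hcs r hr (hst hct)) C₀ ⟨hB, hC⟩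
  refine ⟨C, hsub, hmax.prop.1, hmax.prop.2, fun g ↦ ?_⟩
  by_contra! hcon
  obtain ⟨hgB, hg⟩ := hcon
  have hins : g ∈ C := hmax.le_of_ge (y := insert g C) ⟨?_, ?_⟩ (Set.subset_insert _ _)
    (Set.mem_insert _ _)
  · exact hg 1 h1R (by simpa using hins)
  · rintro c (rfl | hc)
    · exact hgB
    · exact hmax.prop.1 c hc
  · rintro c (rfl | hc) r hr (h | h)
    · simpa using h
    · exact absurd h (hg r hr)
    · exact absurd (by simpa [← h] using hc) (hg _ (hR r hr))
    · exact hmax.prop.2 c hc r hr h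

theorem exists_isMaximalSeparated_glue {ι : Type*} {R L B : Set G} (hR : ∀ r ∈ R, r⁻¹ ∈ R)
    (h1R : 1 ∈ R) (a : ι → G) (B' C' : ι → Set G)
    (h : ∀ i, IsMaximalSeparated R (B' i) (C' i))
    (hB : ∀ i g, g * (a i)⁻¹ ∈ R * L → (g ∈ B ↔ g ∈ B' i))
    (hloc : ∀ i j, a j * (a i)⁻¹ ∈ (R * L)⁻¹ * R * (R * L) → C' i = C' j) :
    ∃ C, IsMaximalSeparated R B C ∧ ∀ i g, g * (a i)⁻¹ ∈ L → (g ∈ C ↔ g ∈ C' i) := by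
  let C₀ : Set G := {c | ∃ i, c * (a i)⁻¹ ∈ R * L ∧ c ∈ C' i}
  have hC₀B : ∀ c ∈ C₀, c ∉ B := by
    rintro c ⟨i, hi, hc⟩
    rw [hB i c hi]
    exact (h i).notMem c hc
  have hC₀ : ∀ c ∈ C₀, ∀ r ∈ R, r * c ∈ C₀ → r = 1 := by
    rintro c ⟨i, hi, hc⟩ r hr ⟨j, hj, hrc⟩
    rw [← hloc i j] at hrc
    · exact (h i).sep c hc r hr hrc
    · convert Set.mul_mem_mul (Set.mul_mem_mul (Set.inv_mem_inv.2 hj) hr) hi using 1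
      group
  obtain ⟨C, hsub, hC⟩ := exists_isMaximalSeparated hR h1R hC₀B hC₀
  refine ⟨C, hC, fun i g hg ↦ ⟨fun hgC ↦ ?_, fun hgC ↦ hsub ⟨i, ?_, hgC⟩⟩⟩
  · have hgB : g ∉ B' i := by
      rw [← hB i g (by simpa using Set.mul_mem_mul h1R hg)]
      exact hC.notMem g hgC
    obtain ⟨r, hr, hrg⟩ := ((h i).cover g).resolve_left hgB
    have : r = 1 := hC.sep g hgC r hr
      (hsub ⟨i, by simpa [mul_assoc] using Set.mul_mem_mul hr hg, hrg⟩)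
    simpa [this] using hrg
  · simpa using Set.mul_mem_mul h1R hg

theorem IsICC.exists_markers (hG : IsICC G) {F : Set G} (hF : F.Finite) (h1F : 1 ∈ F)
    (hFinv : ∀ f ∈ F, f⁻¹ ∈ F) :
    ∃ 𝒟 : Set (Set G),
      (∀ D ∈ 𝒟, ∀ g, {d | d * g ∈ D} ∈ 𝒟) ∧
      (∀ D ∈ 𝒟, ∀ d ∈ D, ∀ f ∈ F, f * d ∈ D → f = 1) ∧
      (∃ M : Set G, M.Finite ∧ ∀ D ∈ 𝒟, ∀ D' ∈ 𝒟, ∃ d ∈ M, d ∈ D ∧ d ∈ D') ∧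
      ∀ L : Set G, L.Finite → ∃ K : Set G, K.Finite ∧ ∀ W : Set (G × Set G),
        (∀ p ∈ W, p.2 ∈ 𝒟) → (∀ p ∈ W, ∀ q ∈ W, q.1 * p.1⁻¹ ∈ K → p.2 = q.2) →
        ∃ D ∈ 𝒟, ∀ p ∈ W, ∀ g, g * p.1⁻¹ ∈ L → (g ∈ D ↔ g ∈ p.2) := by
  obtain ⟨T₁, T₂, h, hT₁, hT₂, h1T₁, hsep₁, hsep₂, hit, hQ⟩ := hG.exists_shapes hF hFinv
  set R₁ := T₁⁻¹ * F * T₁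
  set Q := T₂⁻¹ * F * T₁
  let V := Q ∪ (· * h) '' Q
  let R₂ := T₂⁻¹ * F * T₂ ∪ V * V⁻¹ ∪ {1}
  have hinv : ∀ T : Set G, ∀ r ∈ T⁻¹ * F * T, r⁻¹ ∈ T⁻¹ * F * T := by
    rintro T _ ⟨_, ⟨s, hs, f, hf, rfl⟩, t, ht, rfl⟩
    simpa [mul_assoc] using Set.mul_mem_mul (Set.mul_mem_mul (Set.inv_mem_inv.2 ht) (hFinv f hf))
      (show s⁻¹ ∈ T from hs)
  have hR₁f : R₁.Finite := (hT₁.inv.mul hF).mul hT₁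
  have hQf : Q.Finite := (hT₂.inv.mul hF).mul hT₁
  have hVf : V.Finite := hQf.union (hQf.image _)
  have hR₂f : R₂.Finite :=
    (((hT₂.inv.mul hF).mul hT₂).union (hVf.mul hVf.inv)).union (Set.finite_singleton 1)
  have h1R₁ : 1 ∈ R₁ := by
    simpa using Set.mul_mem_mul (Set.mul_mem_mul (Set.inv_mem_inv.2 h1T₁) h1F) h1T₁
  have h1R₂ : 1 ∈ R₂ := .inr rfl
  have hR₂inv : ∀ r ∈ R₂, r⁻¹ ∈ R₂ := by
    rintro r ((hr | ⟨u, hu, v, hv, rfl⟩) | rfl)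
    · exact .inl (.inl (hinv _ r hr))
    · refine .inl (.inr ⟨v⁻¹, hv, u⁻¹, Set.inv_mem_inv.2 hu, by simp⟩)
    · exact .inr (by simp)
  let B : Set G → Set G := fun C ↦ {g | ∃ q ∈ Q, q * g ∈ C}
  let 𝒟 : Set (Set G) := {D | ∃ C₂ C₁, IsMaximalSeparated R₂ ∅ C₂ ∧
    IsMaximalSeparated R₁ (B C₂) C₁ ∧ D = T₂ * C₂ ∪ T₁ * C₁}
  refine ⟨𝒟, ?_, ?_, ?_, ?_⟩
  · rintro _ ⟨C₂, C₁, h₂, h₁, rfl⟩ g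
    refine ⟨_, {c | c * g ∈ C₁}, h₂.translate g, ?_, ?_⟩
    · convert h₁.translate g using 1
      ext c
      simp [B, mul_assoc]
    · have key : ∀ T C : Set G, ∀ d, d * g ∈ T * C ↔ d ∈ T * {c | c * g ∈ C} := by
        intro T C d
        constructor
        · rintro ⟨t, ht, c, hc, hd⟩
          exact ⟨t, ht, c * g⁻¹, by simpa using hc, by simp [← mul_assoc, hd]⟩
        · rintro ⟨t, ht, c, hc, rfl⟩
          exact ⟨t, ht, c * g, hc, by simp [mul_assoc]⟩
      ext d
      simp only [Set.mem_union, ← key]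
      rfl
  · rintro _ ⟨C₂, C₁, h₂, h₁, rfl⟩
    have same : ∀ {T C R B : Set G}, IsSeparatedPair F T T → IsMaximalSeparated R B C →
        T⁻¹ * F * T ⊆ R → ∀ d ∈ T * C, ∀ f ∈ F, f * d ∈ T * C → f = 1 := by
      rintro T C R B hT hC hTR _ ⟨t, ht, c, hc, rfl⟩ f hf ⟨t', ht', c', hc', heq⟩
      by_contra hf1
      have hc'' : t'⁻¹ * f * t * c = c' := by
        rw [← mul_right_inj t']; exact Eq.trans (by group) heq.symm
      have := hC.sep c hc (t'⁻¹ * f * t)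
        (hTR (Set.mul_mem_mul (Set.mul_mem_mul (Set.inv_mem_inv.2 ht') hf) ht)) (hc'' ▸ hc')
      refine hT f hf hf1 t' ht' t ht ?_
      rw [mul_assoc, inv_mul_eq_one] at this
      exact this
    have mixed : ∀ d ∈ T₁ * C₁, ∀ f ∈ F, f * d ∉ T₂ * C₂ := by
      rintro _ ⟨t, ht, c, hc, rfl⟩ f hf ⟨t', ht', c', hc', heq⟩
      refine h₁.notMem c hc ⟨t'⁻¹ * f * t,
        Set.mul_mem_mul (Set.mul_mem_mul (Set.inv_mem_inv.2 ht') hf) ht, ?_⟩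
      convert hc' using 1
      rw [← mul_right_inj t']; exact Eq.trans (by group) heq.symm
    rintro d (hd | hd) f hf (hd' | hd')
    · exact same hsep₂ h₂ (fun _ h ↦ .inl (.inl h)) d hd f hf hd'
    · exact absurd (by simpa using hd) (mixed _ hd' f⁻¹ (hFinv f hf))
    · exact absurd hd' (mixed d hd f hf)
    · exact same hsep₁ h₁ subset_rfl d hd f hf hd'
  · refine ⟨T₂ * R₂, hT₂.mul hR₂f, ?_⟩
    rintro _ ⟨C₂, C₁, h₂, h₁, rfl⟩ _ ⟨C₂', C₁', h₂', h₁', rfl⟩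
    obtain ⟨c, hcR, hc⟩ := (h₂.cover 1).resolve_left (Set.notMem_empty _)
    rw [mul_one] at hc
    have site : ∀ t ∈ T₂, t * c ∈ T₂ * R₂ ∧ t * c ∈ T₂ * C₂ ∪ T₁ * C₁ := fun t ht ↦
      ⟨Set.mul_mem_mul ht hcR, .inl (Set.mul_mem_mul ht hc)⟩
    rcases h₁'.cover c with ⟨q, hq, hqc⟩ | ⟨r, hr, hrc⟩
    · rcases h₁'.cover (h * c) with ⟨q', hq', hqc'⟩ | ⟨r, hr, hrc⟩
      · have hqq : q' * h * q⁻¹ = 1 := h₂'.sep _ hqc _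
          (.inl (.inr (Set.mul_mem_mul (.inr ⟨q', hq', rfl⟩) (Set.inv_mem_inv.2 (.inl hq)))))
          (by simpa [mul_assoc] using hqc')
        have hq1 := hQ q hq q' hq' (mul_inv_eq_one.1 hqq).symm
        obtain ⟨s, -, hs⟩ := (hit 1 h1R₁).1
        exact ⟨_, (site _ hs).1, (site _ hs).2,
          .inl (Set.mul_mem_mul hs (by simpa [hq1] using hqc))⟩
      · obtain ⟨s, hs, hsr⟩ := (hit r hr).2
        refine ⟨_, (site _ hsr).1, (site _ hsr).2, .inr ?_⟩
        simpa [mul_assoc] using Set.mul_mem_mul hs hrc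
    · obtain ⟨s, hs, hsr⟩ := (hit r hr).1
      refine ⟨_, (site _ hsr).1, (site _ hsr).2, .inr ?_⟩
      simpa [mul_assoc] using Set.mul_mem_mul hs hrc
  · intro L hL
    let L₁ := T₁⁻¹ * L
    let L₂ := Q * (R₁ * L₁) ∪ T₂⁻¹ * L
    have hL₁ : L₁.Finite := hT₁.inv.mul hL
    have hL₂ : L₂.Finite := (hQf.mul (hR₁f.mul hL₁)).union (hT₂.inv.mul hL)
    refine ⟨(R₁ * L₁)⁻¹ * R₁ * (R₁ * L₁) ∪ (R₂ * L₂)⁻¹ * R₂ * (R₂ * L₂),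
      .union (((hR₁f.mul hL₁).inv.mul hR₁f).mul (hR₁f.mul hL₁))
        (((hR₂f.mul hL₂).inv.mul hR₂f).mul (hR₂f.mul hL₂)), fun W hW hloc ↦ ?_⟩
    choose! c₂ c₁ h₂ h₁ hD using fun D (hD : D ∈ 𝒟) ↦ hD
    obtain ⟨C₂, hC₂, hC₂'⟩ := exists_isMaximalSeparated_glue (R := R₂) (L := L₂) (B := ∅) hR₂inv
      h1R₂ (fun p : W ↦ p.1.1) (fun _ ↦ ∅) (fun p ↦ c₂ p.1.2) (fun p ↦ h₂ _ (hW p p.2))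
      (fun _ _ _ ↦ Iff.rfl) (fun p q hpq ↦ by rw [hloc p p.2 q q.2 (.inr hpq)])
    obtain ⟨C₁, hC₁, hC₁'⟩ := exists_isMaximalSeparated_glue (R := R₁) (L := L₁) (B := B C₂)
      (hinv T₁) h1R₁ (fun p : W ↦ p.1.1) (fun p ↦ B (c₂ p.1.2)) (fun p ↦ c₁ p.1.2)
      (fun p ↦ h₁ _ (hW p p.2))
      (fun p g hg ↦ exists_congr fun q ↦ and_congr_right fun hq ↦ hC₂' p _
        (.inl (by simpa [mul_assoc] using Set.mul_mem_mul hq hg)))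
      (fun p q hpq ↦ by rw [hloc p p.2 q q.2 (.inl hpq)])
    refine ⟨_, ⟨C₂, C₁, hC₂, hC₁, rfl⟩, fun p hp g hg ↦ ?_⟩
    have key : ∀ T C C' : Set G, (∀ g, g * p.1⁻¹ ∈ T⁻¹ * L → (g ∈ C ↔ g ∈ C')) →
        (g ∈ T * C ↔ g ∈ T * C') := by
      intro T C C' hCC
      have : ∀ t ∈ T, ∀ c, t * c = g → (c ∈ C ↔ c ∈ C') := by
        rintro t ht c rfl
        refine hCC c ?_
        simpa [mul_assoc] using Set.mul_mem_mul (Set.inv_mem_inv.2 ht) hg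
      constructor
      · rintro ⟨t, ht, c, hc, heq⟩
        exact ⟨t, ht, c, (this t ht c heq).1 hc, heq⟩
      · rintro ⟨t, ht, c, hc, heq⟩
        exact ⟨t, ht, c, (this t ht c heq).2 hc, heq⟩
    rw [hD _ (hW p hp)]
    exact or_congr (key _ _ _ fun g hg ↦ hC₂' ⟨p, hp⟩ g (.inr hg))
      (key _ _ _ fun g hg ↦ hC₁' ⟨p, hp⟩ g hg)

end Markers

section Patterns

variable {G : Type*} [Group G]

/-- A set of configurations, invariant under translations, in which every sufficiently local
family of prescribed values is realized. -/
structure IsFlexible (X : Set (G → Bool)) : Prop where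
  translate : ∀ x ∈ X, ∀ g, (fun h ↦ x (h * g)) ∈ X
  glue : ∃ K : Set G, K.Finite ∧ ∀ W : Set (G × (G → Bool)), (∀ p ∈ W, p.2 ∈ X) →
    (∀ p ∈ W, ∀ q ∈ W, q.1 * p.1⁻¹ ∈ K → p.2 = q.2) → ∃ z ∈ X, ∀ p ∈ W, z p.1 = p.2 p.1

theorem IsFlexible.nonempty {X : Set (G → Bool)} (hX : IsFlexible X) : X.Nonempty := by
  obtain ⟨K, -, hK⟩ := hX.glue
  obtain ⟨z, hz, -⟩ := hK ∅ (by simp) (by simp)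
  exact ⟨z, hz⟩

theorem isFlexible_univ : IsFlexible (Set.univ : Set (G → Bool)) where
  translate _ _ _ := Set.mem_univ _
  glue := by
    classical
    refine ⟨{1}, Set.finite_singleton 1, fun W _ hloc ↦ ?_⟩
    refine ⟨fun g ↦ if h : ∃ x, (g, x) ∈ W then h.choose g else false, Set.mem_univ _, ?_⟩
    rintro ⟨g, x⟩ hp
    have h : ∃ x, (g, x) ∈ W := ⟨x, hp⟩
    have := hloc _ h.choose_spec _ hp (by simp)
    simp only [h, ↓reduceDIte]
    exact congrFun this g

theorem IsICC.exists_pattern (hG : IsICC G) {X : Set (G → Bool)} (hX : IsFlexible X)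
    {P : G → Bool} (hP : P ∈ X) {F : Set G} (hF : F.Finite) :
    ∃ X' ⊆ X, IsFlexible X' ∧ ∃ M : Set G, M.Finite ∧ ∀ x ∈ X', ∀ y ∈ X', ∃ g ∈ M,
      ∀ f ∈ F, x (f * g) = P f ∧ y (f * g) = P f := by
  obtain ⟨K, hK, hglue⟩ := hX.glue
  let K₀ := K ∪ K⁻¹
  have hK₀ : K₀.Finite := hK.union hK.inv
  have hK₀inv : ∀ k ∈ K₀, k⁻¹ ∈ K₀ := by
    rintro k (hk | hk)
    · exact .inr (by simpa using hk)
    · exact .inl hk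
  obtain ⟨𝒟, htrans, hsep, ⟨M, hM, hmeet⟩, hmark⟩ := hG.exists_markers
    (F := F⁻¹ * K₀ * F ∪ {1}) (((hF.inv.mul hK₀).mul hF).union (Set.finite_singleton 1))
    (.inr rfl) (by
      rintro _ (⟨_, ⟨s, hs, k, hk, rfl⟩, t, ht, rfl⟩ | rfl)
      · refine .inl ?_
        simpa [mul_assoc] using Set.mul_mem_mul
          (Set.mul_mem_mul (Set.inv_mem_inv.2 ht) (hK₀inv k hk)) (show s⁻¹ ∈ F from hs)
      · exact .inr (by simp))
  refine ⟨{x ∈ X | ∃ D ∈ 𝒟, ∀ d ∈ D, ∀ f ∈ F, x (f * d) = P f}, fun _ h ↦ h.1, ⟨?_, ?_⟩,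
    M, hM, ?_⟩
  · rintro x ⟨hx, D, hD, hxD⟩ g
    refine ⟨hX.translate x hx g, _, htrans D hD g, fun d hd f hf ↦ ?_⟩
    simpa [mul_assoc] using hxD _ hd f hf
  · let L := F⁻¹ * K₀
    obtain ⟨K₁, hK₁, hglue'⟩ := hmark L (hF.inv.mul hK₀)
    refine ⟨K ∪ K₁ ∪ L⁻¹ * L, (hK.union hK₁).union
      ((hF.inv.mul hK₀).inv.mul (hF.inv.mul hK₀)), fun W hW hloc ↦ ?_⟩
    choose! D hD hxD using fun (w : G → Bool) (hw : ∃ D ∈ 𝒟, ∀ d ∈ D, ∀ f ∈ F, w (f * d) = P f) ↦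
      hw
    obtain ⟨D', hD', hDD⟩ := hglue' ((fun p ↦ (p.1, D p.2)) '' W)
      (by rintro _ ⟨p, hp, rfl⟩; exact hD _ (hW p hp).2) (by
        rintro _ ⟨p, hp, rfl⟩ _ ⟨q, hq, rfl⟩ hpq
        exact congrArg D (hloc p hp q hq (.inl (.inr hpq))))
    have hu : ∀ d ∈ D', ∃ u ∈ X, (∀ f ∈ F, u (f * d) = P f) ∧
        ∀ p ∈ W, d * p.1⁻¹ ∈ L → u = p.2 := by
      intro d hd
      by_cases hnear : ∃ p ∈ W, d * p.1⁻¹ ∈ L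
      · obtain ⟨p, hp, hpL⟩ := hnear
        refine ⟨p.2, (hW p hp).1, hxD _ (hW p hp).2 d ((hDD _ ⟨p, hp, rfl⟩ d hpL).1 hd),
          fun q hq hqL ↦ hloc p hp q hq (.inr ?_)⟩
        simpa [mul_assoc] using Set.mul_mem_mul (Set.inv_mem_inv.2 hqL) hpL
      · exact ⟨_, hX.translate P hP d⁻¹, fun f _ ↦ by simp,
          fun p hp hpL ↦ absurd ⟨p, hp, hpL⟩ hnear⟩
    choose! u huX huP huW using hu
    have hsep' : ∀ d ∈ D', ∀ d' ∈ D', ∀ f ∈ F, ∀ f' ∈ F, f' * d' * (f * d)⁻¹ ∈ K → d = d' := by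
      intro d hd d' hd' f hf f' hf' hk
      have hmem := Set.mul_mem_mul (Set.mul_mem_mul (Set.inv_mem_inv.2 hf')
        (Set.mem_union_left K⁻¹ hk)) hf
      have heq : f'⁻¹ * (f' * d' * (f * d)⁻¹) * f * d = d' := by group
      have := hsep D' hD' d hd _ (.inl hmem) (by rwa [heq])
      rwa [this, one_mul] at heq
    have hnear : ∀ p ∈ W, ∀ d ∈ D', ∀ f ∈ F, f * d * p.1⁻¹ ∈ K₀ → u d = p.2 := by
      intro p hp d hd f hf hk
      refine huW d hd p hp ?_
      simpa [← mul_assoc] using Set.mul_mem_mul (Set.inv_mem_inv.2 hf) hk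
    obtain ⟨z, hz, hzW⟩ := hglue (W ∪ {q | ∃ d ∈ D', ∃ f ∈ F, q = (f * d, u d)}) (by
        rintro _ (hp | ⟨d, hd, f, hf, rfl⟩)
        · exact (hW _ hp).1
        · exact huX d hd) (by
        rintro p (hp | ⟨d, hd, f, hf, rfl⟩) q (hq | ⟨d', hd', f', hf', rfl⟩) hk
        · exact hloc p hp q hq (.inl (.inl hk))
        · exact (hnear p hp d' hd' f' hf' (.inl hk)).symm
        · refine hnear q hq d hd f hf (.inr ?_)
          simpa [mul_assoc] using hk
        · exact congrArg u (hsep' d hd d' hd' f hf f' hf' hk))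
    refine ⟨z, ⟨hz, D', hD', fun d hd f hf ↦ ?_⟩, fun p hp ↦ hzW p (.inl hp)⟩
    exact (hzW _ (.inr ⟨d, hd, f, hf, rfl⟩)).trans (huP d hd f hf)
  · rintro x ⟨-, D, hD, hxD⟩ y ⟨-, D', hD', hyD⟩
    obtain ⟨d, hdM, hd, hd'⟩ := hmeet D hD D' hD'
    exact ⟨d, hdM, fun f hf ↦ ⟨hxD d hd f hf, hyD d hd' f hf⟩⟩

theorem exists_pattern_of_mem_closure {X : Set (G → Bool)} {P : G → Bool} {F M : Set G}
    (hM : M.Finite) (h : ∀ x ∈ X, ∀ y ∈ X, ∃ g ∈ M, ∀ f ∈ F, x (f * g) = P f ∧ y (f * g) = P f)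
    {x y : G → Bool} (hx : x ∈ closure X) (hy : y ∈ closure X) :
    ∃ g ∈ M, ∀ f ∈ F, x (f * g) = P f ∧ y (f * g) = P f := by
  have hclosed : IsClosed (⋃ g ∈ M, ⋂ f ∈ F, {p : (G → Bool) × (G → Bool) |
      p.1 (f * g) = P f} ∩ {p | p.2 (f * g) = P f}) :=
    hM.isClosed_biUnion fun g _ ↦ isClosed_biInter fun f _ ↦
      (isClosed_eq (by fun_prop) (by fun_prop)).inter (isClosed_eq (by fun_prop) (by fun_prop))
  have hsub : X ×ˢ X ⊆ ⋃ g ∈ M, ⋂ f ∈ F, {p : (G → Bool) × (G → Bool) |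
      p.1 (f * g) = P f} ∩ {p | p.2 (f * g) = P f} := by
    rintro ⟨x, y⟩ ⟨hx, hy⟩
    simpa using h x hx y hy
  have hxy : (x, y) ∈ closure (X ×ˢ X) := by
    rw [closure_prod_eq]; exact ⟨hx, hy⟩
  simpa using closure_minimal hsub hclosed hxy

theorem IsICC.exists_subshift [Countable G] (hG : IsICC G) :
    ∃ Y : Set (G → Bool), Y.Nonempty ∧ IsClosed Y ∧ (∀ x ∈ Y, ∀ g, (fun h ↦ x (h * g)) ∈ Y) ∧
      (∀ x ∈ Y, ∃ g h, x g ≠ x h) ∧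
      ∃ F : ℕ → Set G, (∀ g, ∃ m, ∀ n ≥ m, g ∈ F n) ∧
        ∀ n, ∀ x ∈ Y, ∀ y ∈ Y, ∃ g, ∀ f ∈ F n, x (f * g) = y (f * g) := by
  classical
  have := hG.1
  obtain ⟨g₀, hg₀⟩ := exists_ne (1 : G)
  obtain ⟨e, he⟩ := exists_surjective_nat G
  let F : ℕ → Set G := fun n ↦ e '' Set.Iic n
  obtain ⟨X₀, -, hX₀, M₀, hM₀, hpat₀⟩ := hG.exists_pattern isFlexible_univ
    (P := fun g ↦ decide (g = 1)) (Set.mem_univ _) (F := {1, g₀}) (Set.toFinite _)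
  have step : ∀ (n : ℕ) (X : {X : Set (G → Bool) // IsFlexible X}),
      ∃ X' : {X : Set (G → Bool) // IsFlexible X}, X'.1 ⊆ X.1 ∧
        ∃ (P : G → Bool) (M : Set G), M.Finite ∧ ∀ x ∈ X'.1, ∀ y ∈ X'.1, ∃ g ∈ M,
          ∀ f ∈ F n, x (f * g) = P f ∧ y (f * g) = P f := by
    rintro n ⟨X, hX⟩
    obtain ⟨P, hP⟩ := hX.nonempty
    obtain ⟨X', hsub, hX', M, hM, hpat⟩ := hG.exists_pattern hX hP
      ((Set.finite_Iic n).image e)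
    exact ⟨⟨X', hX'⟩, hsub, P, M, hM, hpat⟩
  choose next hsub P M hM hpat using step
  let X : ℕ → {X : Set (G → Bool) // IsFlexible X} := fun n ↦ Nat.rec ⟨X₀, hX₀⟩ next n
  have hY : ∀ {x}, x ∈ ⋂ n, closure (X n).1 → ∀ n, x ∈ closure (X n).1 :=
    fun h ↦ Set.mem_iInter.1 h
  refine ⟨⋂ n, closure (X n).1, ?_, isClosed_iInter fun _ ↦ isClosed_closure, ?_, ?_,
    F, fun g ↦ ?_, fun n x hx y hy ↦ ?_⟩
  · exact IsCompact.nonempty_iInter_of_sequence_nonempty_isCompact_isClosed _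
      (fun n ↦ closure_mono (hsub n (X n))) (fun n ↦ (X n).2.nonempty.closure)
      isClosed_closure.isCompact (fun _ ↦ isClosed_closure)
  · intro x hx g
    refine Set.mem_iInter.2 fun n ↦ ?_
    exact map_mem_closure (f := fun (x : G → Bool) h ↦ x (h * g)) (by fun_prop) (hY hx n)
      fun x hx ↦ (X n).2.translate x hx g
  · intro x hx
    obtain ⟨g, -, hg⟩ := exists_pattern_of_mem_closure hM₀ hpat₀ (hY hx 0) (hY hx 0)
    refine ⟨1 * g, g₀ * g, ?_⟩
    rw [(hg 1 (by simp)).1, (hg g₀ (by simp)).1]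
    simp [hg₀]
  · obtain ⟨m, rfl⟩ := he g
    exact ⟨m, fun n hn ↦ ⟨m, hn, rfl⟩⟩
  · obtain ⟨g, -, hg⟩ := exists_pattern_of_mem_closure (hM n (X n)) (hpat n (X n))
      (hY hx (n + 1)) (hY hy (n + 1))
    exact ⟨g, fun f hf ↦ (hg f hf).1.trans (hg f hf).2.symm⟩

end Patterns

theorem IsICC.not_isStronglyAmenable {G : Type} [Group G] [Countable G] (hG : IsICC G) :
    ¬ IsStronglyAmenable G := by
  obtain ⟨Y, hne, hclosed, htrans, hfix, F, hF, hagree⟩ := hG.exists_subshift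
  intro hSA
  have : Nonempty Y := hne.to_subtype
  have : CompactSpace Y := isCompact_iff_compactSpace.1 hclosed.isCompact
  let act : MulAction G Y :=
    { smul g x := ⟨fun h ↦ x.1 (h * g), htrans x.1 x.2 g⟩
      one_smul x := Subtype.ext (funext fun h ↦ congrArg x.1 (mul_one h))
      mul_smul g g' x := Subtype.ext (funext fun h ↦ congrArg x.1 (mul_assoc h g g').symm) }
  have : ContinuousConstSMul G Y :=
    ⟨fun g ↦ Continuous.subtype_mk (f := fun (x : Y) h ↦ x.1 (h * g))
      (continuous_pi fun h ↦ (continuous_apply (h * g)).comp continuous_subtype_val) _⟩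
  have smul_apply : ∀ (g : G) (x : Y) (h : G), (g • x).1 h = x.1 (h * g) := fun _ _ _ ↦ rfl
  obtain ⟨z, hz⟩ := hSA Y fun x y ↦ by
    choose g hg using fun n ↦ hagree n x.1 x.2 y.1 y.2
    let u : ℕ → Y × Y := fun n ↦ (g n • x, g n • y)
    obtain ⟨⟨z, z'⟩, hlim⟩ : ∃ z : Y × Y, Tendsto u (hyperfilter ℕ) (nhds z) :=
      ⟨_, ((hyperfilter ℕ).map u).le_nhds_lim⟩
    have hzz : z = z' := by
      ext h
      refine tendsto_nhds_unique_of_eventuallyEq (l := (hyperfilter ℕ : Filter ℕ))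
        (f := fun n ↦ (u n).1.1 h) (g := fun n ↦ (u n).2.1 h) ?_ ?_ ?_
      · exact (((continuous_apply h).comp
          (continuous_subtype_val.comp continuous_fst)).tendsto (z, z')).comp hlim
      · exact (((continuous_apply h).comp
          (continuous_subtype_val.comp continuous_snd)).tendsto (z, z')).comp hlim
      · obtain ⟨m, hm⟩ := hF h
        refine Nat.hyperfilter_le_atTop ?_
        filter_upwards [eventually_ge_atTop m] with n hn using hg n h (hm n hn)
    subst hzz
    exact ⟨z, mem_closure_of_tendsto hlim (Eventually.of_forall fun n ↦ ⟨g n, rfl⟩)⟩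
  obtain ⟨g, h, hgh⟩ := hfix z.1 z.2
  refine hgh ?_
  have : ∀ k, z.1 k = z.1 1 := fun k ↦ by
    conv_rhs => rw [← hz k, smul_apply, one_mul]
  rw [this g, this h]

theorem IsStronglyAmenable.quotient {G : Type} [Group G] (hG : IsStronglyAmenable G)
    (N : Subgroup G) [N.Normal] : IsStronglyAmenable (G ⧸ N) := by
  intro X _ _ _ _ _ _ hprox
  let act : MulAction G X := MulAction.compHom X (QuotientGroup.mk' N)
  have smul_def : ∀ (g : G) (x : X), g • x = (g : G ⧸ N) • x := fun _ _ ↦ rfl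
  have : ContinuousConstSMul G X := ⟨fun g ↦ continuous_const_smul (g : G ⧸ N)⟩
  obtain ⟨z, hz⟩ := hG X fun x y ↦ by
    obtain ⟨z, hz⟩ := hprox x y
    refine ⟨z, closure_mono ?_ hz⟩
    rintro _ ⟨g, rfl⟩
    obtain ⟨g, rfl⟩ := QuotientGroup.mk_surjective g
    exact ⟨g, rfl⟩
  refine ⟨z, fun g ↦ ?_⟩
  obtain ⟨g, rfl⟩ := QuotientGroup.mk_surjective g
  exact hz g

section Minimal

variable {G X : Type*} [Group G] [MulAction G X] [TopologicalSpace X]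

theorem exists_minimal_invariant_subset [CompactSpace X] (H : Subgroup G) {M : Set X}
    (hM : IsClosed M) (hne : M.Nonempty) (hinv : ∀ h ∈ H, ∀ x ∈ M, h • x ∈ M) :
    ∃ Y ⊆ M, IsClosed Y ∧ Y.Nonempty ∧ (∀ h ∈ H, ∀ x ∈ Y, h • x ∈ Y) ∧
      ∀ Z ⊆ Y, IsClosed Z → Z.Nonempty → (∀ h ∈ H, ∀ x ∈ Z, h • x ∈ Z) → Z = Y := by
  obtain ⟨Y, hYM, hY⟩ := zorn_superset_nonempty
    {Y : Set X | IsClosed Y ∧ Y.Nonempty ∧ ∀ h ∈ H, ∀ x ∈ Y, h • x ∈ Y} (by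
      intro 𝒞 h𝒞 hchain hne
      refine ⟨⋂₀ 𝒞, ⟨isClosed_sInter fun s hs ↦ (h𝒞 hs).1, ?_, ?_⟩,
        fun s hs ↦ Set.sInter_subset_of_mem hs⟩
      · have := hne.to_subtype
        exact IsCompact.nonempty_sInter_of_directed_nonempty_isCompact_isClosed
          (fun s hs t ht ↦ (hchain.total hs ht).elim (fun h ↦ ⟨s, hs, subset_rfl, h⟩)
            fun h ↦ ⟨t, ht, h, subset_rfl⟩) (fun s hs ↦ (h𝒞 hs).2.1)
          (fun s hs ↦ (h𝒞 hs).1.isCompact)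
          (fun s hs ↦ (h𝒞 hs).1)
      · exact fun h hh x hx s hs ↦ (h𝒞 hs).2.2 h hh x (hx s hs)) M ⟨hM, hne, hinv⟩
  exact ⟨Y, hYM, hY.prop.1, hY.prop.2.1, hY.prop.2.2, fun Z hZY hZ hZne hZinv ↦
    hZY.antisymm (hY.le_of_le ⟨hZ, hZne, hZinv⟩ hZY)⟩

theorem IsProximalAction.exists_mem_closure_of_finiteIndex [ContinuousConstSMul G X]
    (hX : IsProximalAction G X) (N : Subgroup G) [N.Normal] [N.FiniteIndex] (x y : X) :
    ∃ z : X, (z, z) ∈ closure {p : X × X | ∃ n ∈ N, p = (n • x, n • y)} := by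
  obtain ⟨z, hz⟩ := hX x y
  have hsub : {p : X × X | ∃ g : G, p = (g • x, g • y)} ⊆
      ⋃ q : G ⧸ N, {p : X × X | ∃ n ∈ N, p = ((q.out * n) • x, (q.out * n) • y)} := by
    rintro _ ⟨g, rfl⟩
    refine Set.mem_iUnion.2 ⟨g, (g : G ⧸ N).out⁻¹ * g, ?_, by simp⟩
    exact QuotientGroup.eq.1 (QuotientGroup.out_eq' _)
  have hz' := closure_mono hsub hz
  rw [closure_iUnion_of_finite, Set.mem_iUnion] at hz'
  obtain ⟨q, hq⟩ := hz'
  refine ⟨q.out⁻¹ • z, ?_⟩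
  refine map_mem_closure (f := fun p : X × X ↦ (q.out⁻¹ • p.1, q.out⁻¹ • p.2)) ?_ hq ?_
  · exact (continuous_fst.const_smul _).prodMk (continuous_snd.const_smul _)
  · rintro _ ⟨n, hn, rfl⟩
    exact ⟨n, hn, by simp [mul_smul]⟩

/-- If a minimal set for a proximal action is acted on by `g` in a way that commutes with a
finite index normal subgroup, then `g` fixes it pointwise. -/
theorem IsProximalAction.smul_eq_of_commute [CompactSpace X] [T2Space X]
    [ContinuousConstSMul G X] (hX : IsProximalAction G X) {M : Set X} (hM : IsClosed M)
    (hne : M.Nonempty) (hinv : ∀ g : G, ∀ x ∈ M, g • x ∈ M)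
    (hmin : ∀ Z ⊆ M, IsClosed Z → Z.Nonempty → (∀ g : G, ∀ x ∈ Z, g • x ∈ Z) → Z = M)
    (N : Subgroup G) [N.Normal] [N.FiniteIndex] {g : G}
    (hg : ∀ n ∈ N, ∀ x ∈ M, n • g • x = g • n • x) : ∀ x ∈ M, g • x = x := by
  obtain ⟨Y, hYM, hY, ⟨y, hy⟩, hYinv, hYmin⟩ :=
    exists_minimal_invariant_subset N hM hne fun n _ ↦ hinv n
  have hsub : ∀ k : G, ∀ x ∈ Y, k⁻¹ • x ∈ Y := by
    intro k
    have hkY : IsClosed {x | k⁻¹ • x ∈ Y} := hY.preimage (continuous_const_smul _)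
    have hinter : Y ∩ {x | k⁻¹ • x ∈ Y} = Y := by
      refine hYmin _ Set.inter_subset_left (hY.inter hkY) ?_ ?_
      · obtain ⟨z, hz⟩ := hX.exists_mem_closure_of_finiteIndex N y (k • y)
        refine ⟨z, closure_minimal (t := Y ×ˢ {x | k⁻¹ • x ∈ Y}) ?_ (hY.prod hkY) hz⟩
        rintro _ ⟨n, hn, rfl⟩
        refine ⟨hYinv n hn y hy, ?_⟩
        have := hYinv (k⁻¹ * n * k) (by simpa using ‹N.Normal›.conj_mem n hn k⁻¹) y hy
        simpa [mul_smul] using this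
      · rintro n hn x ⟨hx, hx'⟩
        refine ⟨hYinv n hn x hx, ?_⟩
        have := hYinv (k⁻¹ * n * k) (by simpa using ‹N.Normal›.conj_mem n hn k⁻¹) _ hx'
        simpa [mul_smul] using this
    exact fun x hx ↦ (hinter.symm ▸ hx : x ∈ Y ∩ {x | k⁻¹ • x ∈ Y}).2
  have hYeq : Y = M := hmin Y hYM hY ⟨y, hy⟩ fun k x hx ↦ by simpa using hsub k⁻¹ x hx
  subst hYeq
  have hfix : {x ∈ Y | g • x = x} = Y := by
    refine hYmin _ (fun x hx ↦ hx.1)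
      (hY.inter (isClosed_eq (continuous_const_smul g) continuous_id)) ?_ ?_
    · obtain ⟨z, hz⟩ := hX.exists_mem_closure_of_finiteIndex N y (g • y)
      have := closure_minimal (t := {p : X × X | p.1 ∈ Y ∧ g • p.1 = p.2}) ?_ ?_ hz
      · exact ⟨z, this⟩
      · rintro _ ⟨n, hn, rfl⟩
        exact ⟨hYinv n hn y hy, (hg n hn y hy).symm⟩
      · exact (hY.preimage continuous_fst).inter
          (isClosed_eq (continuous_fst.const_smul g) continuous_snd)
    · rintro n hn x ⟨hx, hgx⟩
      exact ⟨hYinv n hn x hx, by rw [← hg n hn x hx, hgx]⟩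
  exact fun x hx ↦ (hfix.symm ▸ hx : x ∈ {x ∈ Y | g • x = x}).2

end Minimal

theorem finiteIndex_centralizer_of_finite {G : Type*} [Group G] {g : G}
    (hg : {h : G | IsConj g h}.Finite) : (Subgroup.centralizer {g}).FiniteIndex := by
  have := hg.to_subtype
  refine @Subgroup.finiteIndex_of_finite_quotient _ _ _ (Finite.of_injective
    (fun q : G ⧸ Subgroup.centralizer {g} ↦
      (⟨q.out * g * q.out⁻¹, isConj_iff.2 ⟨_, rfl⟩⟩ : {h : G | IsConj g h})) ?_)
  intro q q' h
  rw [← q.out_eq', ← q'.out_eq']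
  refine QuotientGroup.eq.2 ?_
  rw [Subgroup.mem_centralizer_iff]
  rintro _ rfl
  have := Subtype.ext_iff.1 h
  simp only at this
  rw [← mul_right_inj q.out, ← mul_left_inj q'.out⁻¹]
  simpa [mul_assoc] using this

theorem isStronglyAmenable_of_forall_quotient_not_isICC {G : Type*} [Group G]
    (hG : ∀ (N : Subgroup G) [N.Normal], ¬ IsICC (G ⧸ N)) : IsStronglyAmenable G := by
  intro X _ _ _ _ _ _ hX
  obtain ⟨M, -, hM, hne, hinv, hmin⟩ := exists_minimal_invariant_subset (⊤ : Subgroup G)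
    (isClosed_univ (X := X)) Set.univ_nonempty (fun _ _ _ _ ↦ Set.mem_univ _)
  simp only [Subgroup.mem_top, forall_const] at hinv hmin
  let K : Subgroup G :=
    { carrier := {g | ∀ x ∈ M, g • x = x}
      one_mem' := fun x _ ↦ one_smul G x
      mul_mem' := fun {a b} ha hb x hx ↦ by rw [mul_smul, hb x hx, ha x hx]
      inv_mem' := fun {a} ha x hx ↦ by rw [inv_smul_eq_iff, ha x hx] }
  have hK : K.Normal := ⟨fun n hn g x hx ↦ by
    rw [mul_smul, mul_smul, hn _ (hinv g⁻¹ x hx), smul_inv_smul]⟩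
  by_cases htriv : Nontrivial (G ⧸ K)
  · have hfc : ∃ q : G ⧸ K, q ≠ 1 ∧ {h | IsConj q h}.Finite := by
      by_contra! hcon
      exact hG K ⟨htriv, fun q hq ↦ hcon q hq⟩
    obtain ⟨q, hq, hfin⟩ := hfc
    obtain ⟨g, rfl⟩ := QuotientGroup.mk_surjective q
    have := finiteIndex_centralizer_of_finite hfin
    let C := (Subgroup.centralizer {(g : G ⧸ K)}).comap (QuotientGroup.mk' K)
    have : C.FiniteIndex := ⟨by
      rw [Subgroup.index_comap_of_surjective _ (QuotientGroup.mk'_surjective K)]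
      exact Subgroup.FiniteIndex.index_ne_zero⟩
    have hcomm : ∀ n ∈ C.normalCore, ∀ x ∈ M, n • g • x = g • n • x := by
      intro n hn x hx
      have hnC : n ∈ C := C.normalCore_le hn
      have hng : ((g * n : G) : G ⧸ K) = ((n * g : G) : G ⧸ K) :=
        Subgroup.mem_centralizer_iff.1 (Subgroup.mem_comap.1 hnC) _ rfl
      have := (QuotientGroup.eq.1 hng) x hx
      rw [mul_smul, inv_smul_eq_iff, mul_smul, mul_smul] at this
      exact this
    have hgK := hX.smul_eq_of_commute hM hne hinv hmin C.normalCore hcomm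
    exact absurd ((QuotientGroup.eq_one_iff (N := K) g).2 hgK) hq
  · obtain ⟨x, hx⟩ := hne
    refine ⟨x, fun g ↦ ?_⟩
    rw [not_nontrivial_iff_subsingleton] at htriv
    exact (QuotientGroup.eq_one_iff g).1 (Subsingleton.elim (α := G ⧸ K) _ _) x hx

/-- A countable discrete group `G` is strongly amenable if and only if no quotient of `G`
is ICC. -/
theorem stronglyAmenable_iff_no_icc_quotient (G : Type) [Group G] [Countable G] :
    IsStronglyAmenable G ↔ ∀ (N : Subgroup G) [N.Normal], ¬ IsICC (G ⧸ N) := by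
  refine ⟨fun hG N _ hN ↦ ?_, isStronglyAmenable_of_forall_quotient_not_isICC⟩
  have : Countable (G ⧸ N) := QuotientGroup.mk_surjective.countable
  exact hN.not_isStronglyAmenable (hG.quotient N)
end

section
/- Let G be a countable discrete group having an ICC quotient, i.e., there is a normal subgroup N of G such that G/N is ICC. Then G is not strongly amenable: there exists a proximal continuous action of G on a nonempty compact Hausdorff space with no fixed point. -/
section PowMem

open Pointwise

variable {G : Type*} [Group G] {W : Set G}

theorem Set.mem_pow_of_mem_of_le (h1 : (1 : G) ∈ W) {m n : ℕ} {x : G} (hx : x ∈ W ^ m)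
    (h : m ≤ n) : x ∈ W ^ n :=
  Set.pow_subset_pow_right h1 h hx

theorem Set.mul_mem_pow_add {m n : ℕ} {x y : G} (hx : x ∈ W ^ m) (hy : y ∈ W ^ n) :
    x * y ∈ W ^ (m + n) := by
  rw [pow_add]; exact Set.mul_mem_mul hx hy

theorem Set.inv_mem_pow (hW : W⁻¹ = W) {m : ℕ} {x : G} (hx : x ∈ W ^ m) : x⁻¹ ∈ W ^ m := by
  rw [← hW, inv_pow]; exact Set.inv_mem_inv.2 hx

/-- Every finite set is contained in a finite symmetric set containing the identity. -/
theorem Set.Finite.exists_symm_superset {P : Set G} (hP : P.Finite) :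
    ∃ W : Set G, P ⊆ W ∧ W.Finite ∧ 1 ∈ W ∧ W⁻¹ = W :=
  ⟨insert 1 (P ∪ P⁻¹), fun _ hx => Or.inr (Or.inl hx), (hP.union hP.inv).insert 1,
    Set.mem_insert _ _, by simp [Set.inv_insert, Set.union_comm]⟩

theorem Set.Finite.group_pow (hW : W.Finite) (n : ℕ) : (W ^ n).Finite := by
  induction n with
  | zero => simp
  | succ n ih => rw [pow_succ]; exact ih.mul hW

end PowMem

section Generic

open Pointwise

variable {G : Type*} [Group G]

/-- In an ICC group finitely many conjugacy equations `y⁻¹ * u * y = v` with `u ≠ 1` can be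
avoided simultaneously. -/
theorem IsICC.exists_forall_conj_ne (hG : IsICC G) (T : Finset (G × G))
    (hT : ∀ t ∈ T, t.1 ≠ 1) : ∃ y : G, ∀ t ∈ T, y⁻¹ * t.1 * y ≠ t.2 := by
  classical
  by_contra! hcon
  let s : G × G → G := fun t => if h : ∃ y : G, y * t.1 * y⁻¹ = t.2 then h.choose else 1
  have hs : ∀ t : G × G, (∃ y : G, y * t.1 * y⁻¹ = t.2) → s t * t.1 * (s t)⁻¹ = t.2 := by
    intro t h
    simp only [s, dif_pos h]
    exact h.choose_spec
  have hcov : ⋃ t ∈ T, s t • (Subgroup.centralizer {t.1} : Set G) = Set.univ := by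
    refine Set.eq_univ_of_forall fun y => ?_
    obtain ⟨t, ht, hy⟩ := hcon y⁻¹
    rw [inv_inv] at hy
    have h1 := hs t ⟨y, hy⟩
    simp only [Set.mem_iUnion]
    refine ⟨t, ht, (s t)⁻¹ * y, ?_, by simp⟩
    rw [SetLike.mem_coe, Subgroup.mem_centralizer_singleton_iff]
    rw [← h1] at hy
    have h2 : (s t)⁻¹ * y * t.1 = (s t)⁻¹ * (y * t.1 * y⁻¹) * y := by group
    rw [h2, hy]; group
  obtain ⟨t, ht, hfin⟩ := Subgroup.exists_finiteIndex_of_leftCoset_cover hcov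
  refine hG.2 t.1 (hT t ht) ?_
  have : Finite (G ⧸ Subgroup.centralizer {t.1}) := Subgroup.finite_quotient_of_finiteIndex
  refine (Set.finite_range fun q : G ⧸ Subgroup.centralizer {t.1} =>
    q.out * t.1 * q.out⁻¹).subset ?_
  rintro h hh
  obtain ⟨c, hc⟩ := isConj_iff.1 hh
  refine ⟨(c : G ⧸ Subgroup.centralizer {t.1}), ?_⟩
  have h1 : (c : G ⧸ Subgroup.centralizer {t.1}).out⁻¹ * c ∈ Subgroup.centralizer {t.1} :=
    QuotientGroup.leftRel_apply.1 (Quotient.exact (Quotient.out_eq _))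
  rw [Subgroup.mem_centralizer_singleton_iff] at h1
  rw [← hc]
  set o := (c : G ⧸ Subgroup.centralizer {t.1}).out
  have h2 : t.1 = (o⁻¹ * c) * t.1 * (o⁻¹ * c)⁻¹ := by rw [h1]; group
  change o * t.1 * o⁻¹ = _
  conv_lhs => rw [h2]
  group

/-- An element `b` avoiding the one-variable equations of low degree over `P`. -/
structure IsGeneric (P : Set G) (b : G) : Prop where
  ne : ∀ p ∈ P, b ≠ p
  conj_ne : ∀ p ∈ P, ∀ q ∈ P, p ≠ 1 → b⁻¹ * p * b ≠ q
  square_ne : ∀ p ∈ P, ∀ q ∈ P, b * p * b ≠ q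
  cubic_ne : ∀ p ∈ P, ∀ q ∈ P, ∀ r ∈ P, p ≠ 1 → b⁻¹ * p * b * q * b ≠ r

theorem IsICC.exists_conj_ne (hG : IsICC G) {Z : Set G} (hZ : Z.Finite) :
    ∃ y : G, ∀ u ∈ Z, ∀ v ∈ Z, u ≠ 1 → y⁻¹ * u * y ≠ v := by
  classical
  obtain ⟨y, hy⟩ := hG.exists_forall_conj_ne
    ((hZ.toFinset ×ˢ hZ.toFinset).filter fun t => t.1 ≠ 1) (fun t ht => (Finset.mem_filter.1 ht).2)
  exact ⟨y, fun u hu v hv h => hy (u, v) (by simp [hu, hv, h])⟩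

/-- There are arbitrarily large finite sets whose elements conjugate each nontrivial element of `P`
to pairwise distinct elements. -/
theorem IsICC.exists_finset_conj_injOn (hG : IsICC G) {P : Set G} (hP : P.Finite) {u : G}
    (hu : u ∈ P) (hu1 : u ≠ 1) (n : ℕ) :
    ∃ X : Finset G, X.card = n ∧
      ∀ p ∈ P, p ≠ 1 → ∀ x ∈ X, ∀ y ∈ X, x ≠ y → x⁻¹ * p * x ≠ y⁻¹ * p * y := by
  classical
  induction n with
  | zero => exact ⟨∅, by simp⟩
  | succ n ih =>
    obtain ⟨X, hX, hinj⟩ := ih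
    have hfin : (P ∪ Set.image2 (fun x p => x⁻¹ * p * x) (X : Set G) P).Finite :=
      hP.union (X.finite_toSet.image2 _ hP)
    obtain ⟨y, hy⟩ := hG.exists_conj_ne hfin
    have key : ∀ p ∈ P, p ≠ 1 → ∀ x ∈ X, y⁻¹ * p * y ≠ x⁻¹ * p * x := fun p hp hp1 x hx =>
      hy p (Or.inl hp) _ (Or.inr ⟨x, hx, p, hp, rfl⟩) hp1
    have hyX : y ∉ X := fun h => key u hu hu1 y h rfl
    refine ⟨insert y X, by rw [Finset.card_insert_of_notMem hyX, hX], ?_⟩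
    intro p hp hp1 a ha b hb hab
    rcases Finset.mem_insert.1 ha with rfl | ha' <;> rcases Finset.mem_insert.1 hb with rfl | hb'
    · exact absurd rfl hab
    · exact key p hp hp1 b hb'
    · exact (key p hp hp1 a ha').symm
    · exact hinj p hp hp1 a ha' b hb' hab

/-- In an ICC group there are generic elements over every finite set. -/
theorem IsICC.exists_isGeneric (hG : IsICC G) {P₀ : Set G} (hP₀ : P₀.Finite) :
    ∃ b : G, IsGeneric P₀ b := by
  classical
  have := hG.1
  obtain ⟨u, hu1⟩ := exists_ne (1 : G)
  set P : Finset G := insert u hP₀.toFinset with hPdef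
  have hP₀P : ∀ p ∈ P₀, p ∈ P := fun p hp => by simp [hPdef, hp]
  have huP : u ∈ P := by simp [hPdef]
  obtain ⟨X, hXcard, hX⟩ := hG.exists_finset_conj_injOn P.finite_toSet huP hu1
    ((P ×ˢ P ×ˢ P ×ˢ (Finset.univ : Finset Bool)).card + 1)
  obtain ⟨W, hXPW, hW, h1W, hWi⟩ := (X.finite_toSet.union P.finite_toSet).exists_symm_superset
  obtain ⟨y, hy⟩ := hG.exists_conj_ne (hW.group_pow 6)
  have hXW : ∀ x ∈ X, x ∈ W ^ 1 := fun x hx => by rw [pow_one]; exact hXPW (Or.inl hx)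
  have hPW : ∀ x ∈ P, x ∈ W ^ 1 := fun x hx => by rw [pow_one]; exact hXPW (Or.inr hx)
  have mul {m n : ℕ} {a b : G} : a ∈ W ^ m → b ∈ W ^ n → a * b ∈ W ^ (m + n) :=
    Set.mul_mem_pow_add
  have inv {m : ℕ} {a : G} : a ∈ W ^ m → a⁻¹ ∈ W ^ m := Set.inv_mem_pow hWi
  have hy' : ∀ {m n : ℕ} {a b : G}, a ∈ W ^ m → b ∈ W ^ n → m ≤ 6 → n ≤ 6 → a ≠ 1 →
      y⁻¹ * a * y ≠ b := fun ha hb hm hn h =>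
    hy _ (Set.mem_pow_of_mem_of_le h1W ha hm) _ (Set.mem_pow_of_mem_of_le h1W hb hn) h
  by_contra! hcon
  have hbad : ∀ x ∈ X, ∃ e ∈ P ×ˢ P ×ˢ P ×ˢ (Finset.univ : Finset Bool),
      (e.2.2.2 = true ∧ x * y * e.1 * (x * y) = e.2.1) ∨
      (e.2.2.2 = false ∧ e.1 ≠ 1 ∧
        (x * y)⁻¹ * e.1 * (x * y) * e.2.1 * (x * y) = e.2.2.1) := by
    intro x hx
    by_contra! hno
    refine hcon (x * y) ⟨?_, ?_, ?_, ?_⟩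
    · intro p hp h
      have hxW := hXW x hx
      refine hy' (hPW u huP) (mul (mul (inv (mul (inv hxW) (hPW p (hP₀P p hp)))) (hPW u huP))
        (mul (inv hxW) (hPW p (hP₀P p hp)))) (by norm_num) (by norm_num) hu1 ?_
      rw [← h]; group
    · intro p hp q hq hp1 h
      have hxW := hXW x hx
      refine hy' (mul (mul (inv hxW) (hPW p (hP₀P p hp))) hxW) (hPW q (hP₀P q hq))
        (by norm_num) (by norm_num) ?_ ?_
      · intro h'
        apply hp1
        have : p = x * (x⁻¹ * p * x) * x⁻¹ := by group
        rw [this, h']; group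
      · rw [← h]; group
    · intro p hp q hq h
      exact (hno (p, q, q, true) (by simp [hP₀P p hp, hP₀P q hq])).1 rfl h
    · intro p hp q hq r hr hp1 h
      exact (hno (p, q, r, false) (by simp [hP₀P p hp, hP₀P q hq, hP₀P r hr])).2 rfl hp1 h
  choose! e heP he using hbad
  obtain ⟨x, hx, z, hz, hxz, hez⟩ := Finset.exists_ne_map_eq_of_card_lt_of_maps_to
    (by rw [hXcard]; exact Nat.lt_succ_self _) heP
  have hex := he x hx
  have hez' := he z hz
  rw [← hez] at hez'
  have hmem := heP x hx
  generalize e x = e at hex hez' hmem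
  obtain ⟨p, q, r, β⟩ := e
  simp only [Finset.mem_product, Finset.mem_univ, and_true] at hmem hex hez'
  obtain ⟨hp, hq, hr⟩ := hmem
  have hxW := hXW x hx
  have hzW := hXW z hz
  rcases hex with ⟨hβ, hex⟩ | ⟨hβ, hp1, hex⟩
  · rcases hez' with ⟨-, hez'⟩ | ⟨hβ', -⟩
    swap
    · rw [hβ] at hβ'; cases hβ'
    refine hy' (mul (inv hzW) hxW)
      (mul (mul (mul (hPW p hp) hzW) (inv hxW)) (inv (hPW p hp))) (by norm_num) (by norm_num) ?_ ?_
    · rw [Ne, inv_mul_eq_one]; exact fun h => hxz h.symm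
    · have h3 : x * y * p * x = z * y * p * z := by
        have h4 := hex.trans hez'.symm
        simpa only [← mul_assoc, mul_left_inj] using h4
      have h5 : y⁻¹ * (z⁻¹ * x) * y = y⁻¹ * z⁻¹ * (x * y * p * x) * x⁻¹ * p⁻¹ := by group
      rw [h5, h3]; group
  · rcases hez' with ⟨hβ', -⟩ | ⟨-, -, hez'⟩
    · rw [hβ] at hβ'; cases hβ'
    refine hy' (mul (mul (mul (inv hzW) (inv (hPW p hp))) hzW)
        (mul (mul (inv hxW) (hPW p hp)) hxW))
      (mul (mul (mul (hPW q hq) hzW) (inv hxW)) (inv (hPW q hq))) (by norm_num) (by norm_num) ?_ ?_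
    · intro h
      refine hX p hp hp1 x hx z hz hxz ?_
      have h4 : x⁻¹ * p * x = (z⁻¹ * p * z) * (z⁻¹ * p⁻¹ * z * (x⁻¹ * p * x)) := by group
      rw [h4, h, mul_one]
    · have h3 : x⁻¹ * p * x * y * q * x = z⁻¹ * p * z * y * q * z := by
        have h4 (x : G) : x⁻¹ * p * x * y * q * x =
            y * ((x * y)⁻¹ * p * (x * y) * q * (x * y)) * y⁻¹ := by group
        rw [h4 x, h4 z, hex, hez']
      have h5 : y⁻¹ * (z⁻¹ * p⁻¹ * z * (x⁻¹ * p * x)) * y =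
        y⁻¹ * z⁻¹ * p⁻¹ * z * (x⁻¹ * p * x * y * q * x) * x⁻¹ * q⁻¹ := by group
      rw [h5, h3]; group

end Generic

section Separated

open Pointwise

variable {G : Type*} [Group G]

/-- Distinct elements of `A` never differ by right multiplication with an element of `D`. -/
def IsRightSeparated (D A : Set G) : Prop :=
  ∀ x ∈ A, ∀ y ∈ A, x⁻¹ * y ∈ D → x = y

/-- In an ICC group there are finite `D`-separated sets `A` and `B` such that every element of
`A * D * A⁻¹` can be multiplied into `B` by an element of `A`. -/
theorem IsICC.exists_isRightSeparated_pair (hG : IsICC G) {D : Set G} (hD : D.Finite)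
    (h1 : 1 ∈ D) (hDi : D⁻¹ = D) :
    ∃ A B : Set G, A.Finite ∧ B.Finite ∧ 1 ∈ A ∧ IsRightSeparated D A ∧ IsRightSeparated D B ∧
      ∀ x ∈ A, ∀ d ∈ D, ∀ y ∈ A, ∃ z ∈ A, x * d * y⁻¹ * z ∈ B := by
  obtain ⟨a, ha⟩ := hG.exists_isGeneric (hD.group_pow 2)
  obtain ⟨T, hDT, hT, h1T, hTi⟩ := (hD.insert a).exists_symm_superset
  obtain ⟨b, hb⟩ := hG.exists_isGeneric (hT.group_pow 6)
  have inv {x : G} (hx : x ∈ D) : x⁻¹ ∈ D := hDi ▸ Set.inv_mem_inv.2 hx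
  have tmul {m n : ℕ} {x y : G} : x ∈ T ^ m → y ∈ T ^ n → x * y ∈ T ^ (m + n) :=
    Set.mul_mem_pow_add
  have tinv {m : ℕ} {x : G} : x ∈ T ^ m → x⁻¹ ∈ T ^ m := Set.inv_mem_pow hTi
  have up {m : ℕ} {x : G} (hx : x ∈ T ^ m) (hm : m ≤ 6 := by norm_num) : x ∈ T ^ 6 :=
    Set.mem_pow_of_mem_of_le h1T hx hm
  have hdT {x : G} (hx : x ∈ D) : x ∈ T ^ 1 := by rw [pow_one]; exact hDT (Or.inr hx)
  have haT : a ∈ T ^ 1 := by rw [pow_one]; exact hDT (Or.inl rfl)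
  have h1T' : (1 : G) ∈ T ^ 6 := Set.one_mem_pow h1T
  have dmul {x y : G} (hx : x ∈ D) (hy : y ∈ D) : x * y ∈ D ^ 2 := by
    rw [pow_two]; exact Set.mul_mem_mul hx hy
  have d2 {x : G} (hx : x ∈ D) : x ∈ D ^ 2 := by simpa using dmul hx h1
  set U : Set G := {1, a} * D * {1, a⁻¹} with hU
  set V : Set G := D * {a, a⁻¹} with hV
  have hUT {x : G} (hx : x ∈ U) : x ∈ T ^ 3 := by
    obtain ⟨_, ⟨s, hs, d, hd, rfl⟩, t, ht, rfl⟩ := hx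
    refine tmul (m := 2) (tmul (m := 1) (n := 1) ?_ (hdT hd)) (n := 1) ?_
    · rcases hs with rfl | rfl
      · exact Set.one_mem_pow h1T
      · exact haT
    · rcases ht with rfl | rfl
      · exact Set.one_mem_pow h1T
      · exact tinv haT
  have hVT {x : G} (hx : x ∈ V) : x ∈ T ^ 2 := by
    obtain ⟨d, hd, t, ht, rfl⟩ := hx
    refine tmul (m := 1) (hdT hd) (n := 1) ?_
    rcases ht with rfl | rfl
    · exact haT
    · exact tinv haT
  have UU : ∀ u ∈ U, ∀ u' ∈ U, (u * b)⁻¹ * (u' * b) ∈ D → u * b = u' * b := by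
    intro u hu u' hu' he
    by_contra hne
    refine hb.conj_ne (u⁻¹ * u') (up (tmul (tinv (hUT hu)) (hUT hu'))) _ (up (hdT he)) ?_ (by group)
    rintro h
    exact hne (by rw [inv_mul_eq_one.1 h])
  have UV : ∀ u ∈ U, ∀ v ∈ V, (u * b)⁻¹ * (b * v) ∉ D := by
    intro u hu v hv he
    by_cases hu1 : u⁻¹ = 1
    · rw [inv_eq_one] at hu1
      subst hu1
      have hvD : v ∈ D := by simpa using he
      obtain ⟨d, hd, t, ht, rfl⟩ := hv
      rcases ht with rfl | rfl
      · exact ha.ne _ (dmul (inv hd) hvD) (by group)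
      · exact ha.ne _ (dmul (inv hvD) hd) (by group)
    · exact hb.conj_ne u⁻¹ (up (tinv (hUT hu))) _ (up (tmul (hdT he) (tinv (hVT hv)))) hu1
        (by group)
  have UN : ∀ u ∈ U, ∀ v ∈ U, (u * b)⁻¹ * (v * b⁻¹) ∉ D := by
    intro u hu v hv he
    exact hb.square_ne _ (up (hdT he)) (u⁻¹ * v) (up (tmul (tinv (hUT hu)) (hUT hv))) (by group)
  have UC : ∀ u ∈ U, ∀ d ∈ D, (u * b)⁻¹ * (b * d * b⁻¹) ∉ D := by
    intro u hu d hd he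
    by_cases hu1 : u = 1
    · subst hu1
      refine hb.ne _ (up (tmul (tinv (hdT he)) (hdT hd))) (by group)
    · exact hb.cubic_ne u (up (hUT hu)) _ (up (hdT he)) d (up (hdT hd)) hu1 (by group)
  have VV : ∀ u ∈ V, ∀ v ∈ V, (b * u)⁻¹ * (b * v) ∈ D → b * u = b * v := by
    intro u hu v hv he
    have he' : u⁻¹ * v ∈ D := by
      have : u⁻¹ * v = (b * u)⁻¹ * (b * v) := by group
      rwa [this]
    by_contra hne
    obtain ⟨c, hc, s, hs, rfl⟩ := hu
    obtain ⟨d, hd, t, ht, rfl⟩ := hv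
    simp only at he' hne
    rcases hs with rfl | rfl <;> rcases ht with rfl | rfl
    · refine ha.conj_ne (c⁻¹ * d) (dmul (inv hc) hd) _ (d2 he') ?_ (by group)
      intro h
      exact hne (by rw [inv_mul_eq_one.1 h])
    · exact ha.square_ne _ (d2 he') (c⁻¹ * d) (dmul (inv hc) hd) (by group)
    · exact ha.square_ne (c⁻¹ * d) (dmul (inv hc) hd) _ (d2 he') (by group)
    · refine ha.conj_ne _ (d2 he') (c⁻¹ * d) (dmul (inv hc) hd) ?_ (by group)
      intro h
      exact hne (by rw [inv_mul_eq_one.1 h])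
  have VN : ∀ v ∈ V, ∀ u ∈ U, (b * v)⁻¹ * (u * b⁻¹) ∉ D := by
    intro v hv u hu he
    exact hb.square_ne _ (up (tmul (hVT hv) (hdT he))) u (up (hUT hu)) (by group)
  have VC : ∀ v ∈ V, ∀ d ∈ D, (b * v)⁻¹ * (b * d * b⁻¹) ∉ D := by
    intro v hv d hd he
    exact hb.ne _ (up (tmul (tmul (tinv (hdT he)) (tinv (hVT hv))) (hdT hd))) (by group)
  have NN : ∀ u ∈ U, ∀ v ∈ U, (u * b⁻¹)⁻¹ * (v * b⁻¹) ∈ D → u * b⁻¹ = v * b⁻¹ := by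
    intro u hu v hv he
    by_contra hne
    refine hb.conj_ne _ (up (hdT he)) (u⁻¹ * v) (up (tmul (tinv (hUT hu)) (hUT hv))) ?_ (by group)
    intro h
    exact hne (inv_mul_eq_one.1 h)
  have NC : ∀ u ∈ U, ∀ d ∈ D, (u * b⁻¹)⁻¹ * (b * d * b⁻¹) ∉ D := by
    intro u hu d hd he
    by_cases he1 : ((u * b⁻¹)⁻¹ * (b * d * b⁻¹))⁻¹ = 1
    · have h : b = u * d⁻¹ := by
        rw [inv_eq_one, inv_mul_eq_one] at he1
        have h3 : u * b⁻¹ * (b * d⁻¹) = b := by rw [he1]; group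
        rw [← h3]; group
      exact hb.ne _ (up (tmul (hUT hu) (tinv (hdT hd)))) h
    · exact hb.cubic_ne _ (up (tinv (hdT he))) u⁻¹ (up (tinv (hUT hu))) d⁻¹ (up (tinv (hdT hd)))
        he1 (by group)
  have CC : ∀ c ∈ D, ∀ d ∈ D, (b * c * b⁻¹)⁻¹ * (b * d * b⁻¹) ∈ D →
      b * c * b⁻¹ = b * d * b⁻¹ := by
    intro c hc d hd he
    by_contra hne
    refine hb.conj_ne _ (up (hdT he)) (c⁻¹ * d) (up (tmul (tinv (hdT hc)) (hdT hd))) ?_ (by group)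
    intro h
    exact hne (inv_mul_eq_one.1 h)
  have flip {x y : G} (h : x⁻¹ * y ∈ D) : y⁻¹ * x ∈ D := by
    have := inv h
    rwa [mul_inv_rev, inv_inv] at this
  have haD : a ∉ D := fun h => ha.ne a (d2 h) rfl
  have hbT {n : ℕ} (hn : n ≤ 6) : b ∉ T ^ n := fun h => hb.ne b (up h hn) rfl
  refine ⟨{1, a, b}, U * {b} ∪ {b} * V ∪ U * {b⁻¹} ∪ {b} * D * {b⁻¹}, by simp, ?_, by simp,
    ?_, ?_, ?_⟩
  · have hUf : U.Finite := ((Set.toFinite _).mul hD).mul (Set.toFinite _)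
    have hVf : V.Finite := hD.mul (Set.toFinite _)
    exact (((hUf.mul (Set.toFinite _)).union ((Set.toFinite _).mul hVf)).union
      (hUf.mul (Set.toFinite _))).union (((Set.toFinite _).mul hD).mul (Set.toFinite _))
  · have key1 : (1 : G)⁻¹ * a ∉ D := by simpa using haD
    have key2 : (1 : G)⁻¹ * b ∉ D := fun h => hbT (n := 1) (by norm_num) (by simpa using hdT h)
    have key3 : a⁻¹ * b ∉ D := fun h => hbT (n := 2) (by norm_num) (by
      have := tmul haT (hdT h)
      simpa using this)
    rintro x (rfl | rfl | rfl) y (rfl | rfl | rfl) h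
    exacts [rfl, absurd h key1, absurd h key2, absurd (flip h) key1, rfl, absurd h key3,
      absurd (flip h) key2, absurd (flip h) key3, rfl]
  · rintro _ (((⟨u, hu, _, rfl, rfl⟩ | ⟨_, rfl, u, hu, rfl⟩) | ⟨u, hu, _, rfl, rfl⟩) |
        ⟨_, ⟨_, rfl, u, hu, rfl⟩, _, rfl, rfl⟩)
      _ (((⟨v, hv, _, rfl, rfl⟩ | ⟨_, rfl, v, hv, rfl⟩) | ⟨v, hv, _, rfl, rfl⟩) |
        ⟨_, ⟨_, rfl, v, hv, rfl⟩, _, rfl, rfl⟩) h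
    exacts [UU u hu v hv h, absurd h (UV u hu v hv), absurd h (UN u hu v hv),
      absurd h (UC u hu v hv),
      absurd (flip h) (UV v hv u hu), VV u hu v hv h, absurd h (VN u hu v hv),
      absurd h (VC u hu v hv),
      absurd (flip h) (UN v hv u hu), absurd (flip h) (VN v hv u hu), NN u hu v hv h,
      absurd h (NC u hu v hv),
      absurd (flip h) (UC v hv u hu), absurd (flip h) (VC v hv u hu),
      absurd (flip h) (NC v hv u hu), CC u hu v hv h]
  · have mU {d : G} (hd : d ∈ D) {s t : G} (hs : s ∈ ({1, a} : Set G))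
        (ht : t ∈ ({1, a⁻¹} : Set G)) : s * d * t ∈ U := Set.mul_mem_mul (Set.mul_mem_mul hs hd) ht
    have h1a : (1 : G) ∈ ({1, a} : Set G) := Or.inl rfl
    have haa : a ∈ ({1, a} : Set G) := Or.inr rfl
    have h1a' : (1 : G) ∈ ({1, a⁻¹} : Set G) := Or.inl rfl
    have haa' : a⁻¹ ∈ ({1, a⁻¹} : Set G) := Or.inr rfl
    have posU {u : G} (hu : u ∈ U) :
        u * b ∈ U * {b} ∪ {b} * V ∪ U * {b⁻¹} ∪ {b} * D * {b⁻¹} :=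
      Or.inl (Or.inl (Or.inl (Set.mul_mem_mul hu rfl)))
    have posV {v : G} (hv : v ∈ V) :
        b * v ∈ U * {b} ∪ {b} * V ∪ U * {b⁻¹} ∪ {b} * D * {b⁻¹} :=
      Or.inl (Or.inl (Or.inr (Set.mul_mem_mul rfl hv)))
    have posN {u : G} (hu : u ∈ U) :
        u * b⁻¹ ∈ U * {b} ∪ {b} * V ∪ U * {b⁻¹} ∪ {b} * D * {b⁻¹} :=
      Or.inl (Or.inr (Set.mul_mem_mul hu rfl))
    have posC {d : G} (hd : d ∈ D) :
        b * d * b⁻¹ ∈ U * {b} ∪ {b} * V ∪ U * {b⁻¹} ∪ {b} * D * {b⁻¹} :=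
      Or.inr (Set.mul_mem_mul (Set.mul_mem_mul rfl hd) rfl)
    rintro x (rfl | rfl | rfl) d hd y (rfl | rfl | rfl)
    · exact ⟨b, by simp, by simpa using posU (mU hd h1a h1a')⟩
    · exact ⟨b, by simp, by simpa using posU (mU hd h1a haa')⟩
    · exact ⟨1, by simp, by simpa using posN (mU hd h1a h1a')⟩
    · exact ⟨b, by simp, by simpa using posU (mU hd haa h1a')⟩
    · exact ⟨b, by simp, by simpa using posU (mU hd haa haa')⟩
    · exact ⟨1, by simp, by simpa using posN (mU hd haa h1a')⟩
    · refine ⟨a, by simp, ?_⟩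
      have := posV (Set.mul_mem_mul hd (Or.inl rfl : a ∈ ({a, a⁻¹} : Set G)))
      simpa [mul_assoc] using this
    · refine ⟨1, by simp, ?_⟩
      have := posV (Set.mul_mem_mul hd (Or.inr rfl : y⁻¹ ∈ ({y, y⁻¹} : Set G)))
      simpa [mul_assoc] using this
    · exact ⟨1, by simp, by simpa using posC hd⟩

end Separated

section Gluing

open Pointwise

variable {G : Type*} [Group G]

/-- A closed shift-invariant set of configurations in which configurations assigned to the points
of a set `E` can be glued along `E`, provided that they coincide at `D`-close points. -/
structure IsGluingShift (D : Set G) (S : Set (G → Bool)) : Prop where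
  isClosed : IsClosed S
  shift_mem : ∀ x ∈ S, ∀ g : G, (fun h => x (g * h)) ∈ S
  exists_glue : ∀ (E : Set G) (y : G → G → Bool), (∀ g ∈ E, y g ∈ S) →
    (∀ g ∈ E, ∀ h ∈ E, g⁻¹ * h ∈ D → y g = y h) → ∃ z ∈ S, ∀ g ∈ E, z g = y g g

theorem IsGluingShift.mono {D D' : Set G} {S : Set (G → Bool)} (hS : IsGluingShift D S)
    (h : D ⊆ D') : IsGluingShift D' S :=
  ⟨hS.isClosed, hS.shift_mem, fun E y hy hy' =>
    hS.exists_glue E y hy fun g hg k hk hgk => hy' g hg k hk (h hgk)⟩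

theorem IsGluingShift.nonempty {D : Set G} {S : Set (G → Bool)} (hS : IsGluingShift D S) :
    S.Nonempty := by
  obtain ⟨z, hz, -⟩ := hS.exists_glue ∅ (fun _ _ => false) (by simp) (by simp)
  exact ⟨z, hz⟩

/-- Gluing along the thickening `E * R` of `E`. -/
theorem IsGluingShift.exists_glue_mul {D R : Set G} {S : Set (G → Bool)}
    (hS : IsGluingShift D S) (h1 : 1 ∈ D) (E : Set G) (y : G → G → Bool) (hy : ∀ g ∈ E, y g ∈ S)
    (hyE : ∀ g ∈ E, ∀ h ∈ E, g⁻¹ * h ∈ R * D * R⁻¹ → y g = y h) :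
    ∃ z ∈ S, ∀ g ∈ E, ∀ r ∈ R, z (g * r) = y g (g * r) := by
  classical
  have hex : ∀ e ∈ E * R, ∃ g ∈ E, ∃ r ∈ R, g * r = e := fun e he => he
  choose! c hcE r hrR hcr using hex
  have key : ∀ e ∈ E * R, ∀ g ∈ E, ∀ s ∈ R, e⁻¹ * (g * s) ∈ D → y (c e) = y g := by
    intro e he g hg s hs h
    refine hyE _ (hcE e he) g hg ?_
    refine ⟨_, ⟨r e, hrR e he, _, h, rfl⟩, s⁻¹, Set.inv_mem_inv.2 hs, ?_⟩
    have := hcr e he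
    simp only
    rw [← eq_inv_mul_iff_mul_eq] at this
    rw [this]; group
  obtain ⟨z, hz, hzE⟩ := hS.exists_glue (E * R) (fun e => y (c e)) (fun e he => hy _ (hcE e he))
    (fun e he e' he' h => by
      have h2 := hcr e' he'
      exact key e he _ (hcE e' he') _ (hrR e' he') (by rwa [h2]))
  refine ⟨z, hz, fun g hg s hs => ?_⟩
  have hgs : g * s ∈ E * R := Set.mul_mem_mul hg hs
  rw [hzE _ hgs]
  exact congrFun (key _ hgs g hg s hs (by simpa using h1)) _

/-- Indicator functions of the sets that are `F`-separated and meet every translate of `F`. -/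
def separatedSyndetic (F : Set G) : Set (G → Bool) :=
  {m | ∀ g, (m g = true → ∀ f ∈ F, m (g * f) = true → f = 1) ∧ ∃ f ∈ F, m (g * f) = true}

theorem isClosed_setOf_eval_eq {ι : Type*} (i : ι) (b : Bool) : IsClosed {x : ι → Bool | x i = b} :=
  isClosed_eq (continuous_apply i) continuous_const

theorem isGluingShift_separatedSyndetic {F : Set G} (hF : F.Finite) (h1 : 1 ∈ F)
    (hFi : F⁻¹ = F) : IsGluingShift (F ^ 3) (separatedSyndetic F) where
  isClosed := by
    have : separatedSyndetic F = ⋂ g, ((⋂ f ∈ F, {m : G → Bool | m g = true → m (g * f) = true →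
        f = 1}) ∩ ⋃ f ∈ F, {m : G → Bool | m (g * f) = true}) := by
      ext m
      simp only [separatedSyndetic, Set.mem_ofPred_eq, Set.mem_iInter, Set.mem_inter_iff,
        Set.mem_iUnion, exists_prop]
      exact forall_congr' fun g => and_congr_left fun _ => by tauto
    rw [this]
    refine isClosed_iInter fun g => IsClosed.inter (isClosed_biInter fun f hf => ?_)
      (hF.isClosed_biUnion fun f _ => isClosed_setOf_eval_eq _ _)
    have : {m : G → Bool | m g = true → m (g * f) = true → f = 1} =
        ({m : G → Bool | m g = false} ∪ {m : G → Bool | m (g * f) = false}) ∪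
          {_m : G → Bool | f = 1} := by
      ext m
      simp only [Set.mem_ofPred_eq, Set.mem_union]
      cases m g <;> cases m (g * f) <;> simp
    rw [this]
    exact ((isClosed_setOf_eval_eq _ _).union (isClosed_setOf_eval_eq _ _)).union isClosed_const
  shift_mem := by
    intro m hm g h
    have := hm (g * h)
    simpa only [mul_assoc] using this
  exists_glue := by
    classical
    intro E y hy hyE
    have inv {x : G} (hx : x ∈ F) : x⁻¹ ∈ F := hFi ▸ Set.inv_mem_inv.2 hx
    have mul3 {a b c : G} (ha : a ∈ F) (hb : b ∈ F) (hc : c ∈ F) : a * b * c ∈ F ^ 3 := by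
      rw [pow_succ, pow_two]; exact Set.mul_mem_mul (Set.mul_mem_mul ha hb) hc
    set M₀ : Set G := {h | ∃ g ∈ E, ∃ f ∈ F, h = g * f ∧ y g h = true} with hM₀
    have hM₀s : IsRightSeparated F M₀ := by
      rintro _ ⟨g, hg, f, hf, rfl, hgf⟩ _ ⟨g', hg', f', hf', rfl, hgf'⟩ h
      have hgg' : y g = y g' := by
        refine hyE g hg g' hg' ?_
        have := mul3 hf h (inv hf')
        convert this using 1; group
      rw [← hgg'] at hgf'
      have := (hy g hg (g * f)).1 hgf _ h (by rw [mul_inv_cancel_left]; exact hgf')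
      exact inv_mul_eq_one.1 this
    obtain ⟨M, hM₀M, hM⟩ := zorn_subset_nonempty {M | IsRightSeparated F M}
      (by
        intro c hc hch hne
        refine ⟨⋃₀ c, ?_, fun s hs => Set.subset_sUnion_of_mem hs⟩
        rintro x ⟨s, hs, hxs⟩ z ⟨t, ht, hzt⟩ h
        rcases hch.total hs ht with hst | hts
        · exact hc ht x (hst hxs) z hzt h
        · exact hc hs x hxs z (hts hzt) h) M₀ hM₀s
    have hMs : IsRightSeparated F M := hM.prop
    have hMsyn : ∀ g, ∃ f ∈ F, g * f ∈ M := by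
      intro g
      by_contra! hno
      have hins : IsRightSeparated F (insert g M) := by
        rintro x (rfl | hx) z (rfl | hz) h
        · rfl
        · exact absurd (by simpa using hz) (hno _ h)
        · exact absurd (by simpa using hx) (hno _ (inv h))
        · exact hMs x hx z hz h
      have hg : g ∈ M := hM.le_of_ge hins (Set.subset_insert _ _) (Set.mem_insert _ _)
      exact hno 1 h1 (by simpa using hg)
    refine ⟨fun g => decide (g ∈ M), fun g => ⟨fun hg f hf hgf => ?_, ?_⟩, fun e he => ?_⟩
    · have := hMs g (by simpa using hg) (g * f) (by simpa using hgf) (by simpa using hf)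
      simpa using this
    · simpa using hMsyn g
    · cases hye : y e e with
      | true => exact decide_eq_true (hM₀M ⟨e, he, 1, h1, by simp, hye⟩)
      | false =>
        refine decide_eq_false fun heM => ?_
        obtain ⟨f, hf, hef⟩ := (hy e he e).2
        have h2 : e * f ∈ M := hM₀M ⟨e, he, f, hf, rfl, hef⟩
        have h3 := hMs e heM _ h2 (by simpa using hf)
        rw [← h3, hye] at hef
        cases hef

end Gluing

section Markers

open Pointwise Classical

variable {G : Type*} [Group G]

/-- The indicator function of `m₂ * A₂ ∪ (m₁ * A₁ \ m₂ * A₂ * D⁻¹)`. -/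
noncomputable def markerSet (D A₁ A₂ : Set G) (m : (G → Bool) × (G → Bool)) : G → Bool := fun c =>
  decide ((∃ a ∈ A₂, m.2 (c * a⁻¹) = true) ∨
    ((∃ a ∈ A₁, m.1 (c * a⁻¹) = true) ∧ ∀ a ∈ A₂, ∀ d ∈ D, ¬ m.2 (c * d * a⁻¹) = true))

theorem markerSet_eq_true {D A₁ A₂ : Set G} {m : (G → Bool) × (G → Bool)} {c : G} :
    markerSet D A₁ A₂ m c = true ↔ (∃ a ∈ A₂, m.2 (c * a⁻¹) = true) ∨
      ((∃ a ∈ A₁, m.1 (c * a⁻¹) = true) ∧ ∀ a ∈ A₂, ∀ d ∈ D, ¬ m.2 (c * d * a⁻¹) = true) := by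
  simp [markerSet]

theorem continuous_markerSet {D A₁ A₂ : Set G} (hD : D.Finite) (hA₁ : A₁.Finite)
    (hA₂ : A₂.Finite) : Continuous (markerSet D A₁ A₂) := by
  refine continuous_pi fun c => (continuous_bool_rng true).2 ?_
  have h₁ (g : G) : IsClopen {m : (G → Bool) × (G → Bool) | m.1 g = true} :=
    (isClopen_discrete {true}).preimage ((continuous_apply g).comp continuous_fst)
  have h₂ (g : G) : IsClopen {m : (G → Bool) × (G → Bool) | m.2 g = true} :=
    (isClopen_discrete {true}).preimage ((continuous_apply g).comp continuous_snd)
  have h := (hA₂.isClopen_biUnion fun a _ => h₂ (c * a⁻¹)).union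
    ((hA₁.isClopen_biUnion fun a _ => h₁ (c * a⁻¹)).inter
      (hA₂.isClopen_biInter fun a _ => hD.isClopen_biInter fun d _ => (h₂ (c * d * a⁻¹)).compl))
  convert h using 1
  ext m
  simp [markerSet]

/-- The image of two gluing shifts under `markerSet` is a gluing shift. -/
theorem isGluingShift_image_markerSet {D A₁ A₂ Q : Set G} (hD : D.Finite) (hA₁ : A₁.Finite)
    (hA₂ : A₂.Finite) (h1 : 1 ∈ Q) {S₁ S₂ : Set (G → Bool)} (hS₁ : IsGluingShift Q S₁)
    (hS₂ : IsGluingShift Q S₂) :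
    IsGluingShift ((A₂⁻¹ ∪ A₁⁻¹ ∪ D * A₂⁻¹) * Q * (A₂⁻¹ ∪ A₁⁻¹ ∪ D * A₂⁻¹)⁻¹)
      (markerSet D A₁ A₂ '' (S₁ ×ˢ S₂)) where
  isClosed := ((hS₁.isClosed.prod hS₂.isClosed).isCompact.image
    (continuous_markerSet hD hA₁ hA₂)).isClosed
  shift_mem := by
    rintro _ ⟨⟨m₁, m₂⟩, ⟨hm₁, hm₂⟩, rfl⟩ g
    refine ⟨(fun h => m₁ (g * h), fun h => m₂ (g * h)),
      ⟨hS₁.shift_mem _ hm₁ g, hS₂.shift_mem _ hm₂ g⟩, ?_⟩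
    ext c
    simp only [markerSet, mul_assoc]
  exists_glue := by
    intro E y hy hyE
    set R := A₂⁻¹ ∪ A₁⁻¹ ∪ D * A₂⁻¹ with hR
    have hex : ∀ x ∈ markerSet D A₁ A₂ '' (S₁ ×ˢ S₂), ∃ m : (G → Bool) × (G → Bool),
        (m.1 ∈ S₁ ∧ m.2 ∈ S₂) ∧ markerSet D A₁ A₂ m = x := fun x hx => hx
    choose! m hm hmx using hex
    obtain ⟨z₁, hz₁, hzE₁⟩ := hS₁.exists_glue_mul (R := R) h1 E (fun g => (m (y g)).1)
      (fun g hg => (hm _ (hy g hg)).1) (fun g hg h hh hgh => by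
        simp only [hyE g hg h hh hgh])
    obtain ⟨z₂, hz₂, hzE₂⟩ := hS₂.exists_glue_mul (R := R) h1 E (fun g => (m (y g)).2)
      (fun g hg => (hm _ (hy g hg)).2) (fun g hg h hh hgh => by
        simp only [hyE g hg h hh hgh])
    refine ⟨_, ⟨(z₁, z₂), ⟨hz₁, hz₂⟩, rfl⟩, fun g hg => ?_⟩
    rw [← congrFun (hmx _ (hy g hg)) g, Bool.eq_iff_iff, markerSet_eq_true, markerSet_eq_true]
    have e₁ : ∀ a ∈ A₁, z₁ (g * a⁻¹) = (m (y g)).1 (g * a⁻¹) := fun a ha =>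
      hzE₁ g hg _ (Or.inl (Or.inr (Set.inv_mem_inv.2 ha)))
    have e₂ : ∀ a ∈ A₂, z₂ (g * a⁻¹) = (m (y g)).2 (g * a⁻¹) := fun a ha =>
      hzE₂ g hg _ (Or.inl (Or.inl (Set.inv_mem_inv.2 ha)))
    have e₃ : ∀ a ∈ A₂, ∀ d ∈ D, z₂ (g * d * a⁻¹) = (m (y g)).2 (g * d * a⁻¹) := by
      intro a ha d hd
      rw [mul_assoc]
      exact hzE₂ g hg _ (Or.inr (Set.mul_mem_mul hd (Set.inv_mem_inv.2 ha)))
    dsimp only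
    refine or_congr (exists_congr fun a => and_congr_right fun ha => by rw [e₂ a ha])
      (and_congr (exists_congr fun a => and_congr_right fun ha => by rw [e₁ a ha])
        (forall_congr' fun a => forall_congr' fun ha => forall_congr' fun d =>
          forall_congr' fun hd => by rw [e₃ a ha d hd]))

/-- In an ICC group there is a gluing shift of `D`-separated sets any two of which intersect. -/
theorem IsICC.exists_markers_s3 (hG : IsICC G) {D : Set G} (hD : D.Finite)
    (h1 : 1 ∈ D) (hDi : D⁻¹ = D) :
    ∃ (Q : Set G) (K : Set (G → Bool)), Q.Finite ∧ 1 ∈ Q ∧ IsGluingShift Q K ∧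
      (∀ C ∈ K, IsRightSeparated D {g | C g = true}) ∧
      ∀ C ∈ K, ∀ C' ∈ K, ∃ g, C g = true ∧ C' g = true := by
  obtain ⟨A, B, hA, hB, h1A, hAs, hBs, hAB⟩ := hG.exists_isRightSeparated_pair hD h1 hDi
  have dinv {x : G} (hx : x ∈ D) : x⁻¹ ∈ D := hDi ▸ Set.inv_mem_inv.2 hx
  have hBne : B.Nonempty := by
    obtain ⟨z, -, hz⟩ := hAB 1 h1A 1 h1 1 h1A
    exact ⟨_, hz⟩
  set H : Set G := B * D * B⁻¹ with hH
  have hHf : H.Finite := (hB.mul hD).mul hB.inv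
  obtain ⟨t, ht⟩ := hG.exists_isGeneric (hHf.union (hHf.mul hHf.inv))
  have memH {b d b' : G} (hb : b ∈ B) (hd : d ∈ D) (hb' : b' ∈ B) : b * d * b'⁻¹ ∈ H :=
    Set.mul_mem_mul (Set.mul_mem_mul hb hd) (Set.inv_mem_inv.2 hb')
  set A₂ : Set G := B ∪ {t} * B with hA₂
  have hA₂f : A₂.Finite := hB.union ((Set.finite_singleton t).mul hB)
  have memA₂ : ∀ x ∈ A₂, x ∈ B ∨ ∃ z ∈ B, x = t * z := by
    rintro x (hx | ⟨s, hs, z, hz, rfl⟩)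
    · exact Or.inl hx
    · exact Or.inr ⟨z, hz, by rw [Set.mem_singleton_iff.1 hs]⟩
  have hA₂s : IsRightSeparated D A₂ := by
    have key : ∀ x ∈ B, ∀ z ∈ B, x⁻¹ * (t * z) ∉ D := fun x hx z hz h =>
      ht.ne _ (Or.inl (memH hx h hz)) (by group)
    intro x hx z hz h
    rcases memA₂ x hx with hx | ⟨x, hxB, rfl⟩ <;> rcases memA₂ z hz with hz | ⟨z, hzB, rfl⟩
    · exact hBs x hx z hz h
    · exact absurd h (key x hx z hzB)
    · refine absurd (dinv h) ?_
      simpa using key z hz x hxB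
    · rw [hBs x hxB z hzB (by simpa [mul_assoc] using h)]
  set F₁ : Set G := A * D * A⁻¹ with hF₁
  set L : Set G := A₂ * D * A₂⁻¹ with hL
  have memL {b d b' : G} (hb : b ∈ A₂) (hd : d ∈ D) (hb' : b' ∈ A₂) : b * d * b'⁻¹ ∈ L :=
    Set.mul_mem_mul (Set.mul_mem_mul hb hd) (Set.inv_mem_inv.2 hb')
  set F₂ : Set G := L * L with hF₂
  have hF₁i : F₁⁻¹ = F₁ := by simp only [hF₁, mul_inv_rev, inv_inv, hDi, mul_assoc]
  have hLi : L⁻¹ = L := by simp only [hL, mul_inv_rev, inv_inv, hDi, mul_assoc]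
  have hF₂i : F₂⁻¹ = F₂ := by rw [hF₂, mul_inv_rev, hLi]
  have h1F₁ : (1 : G) ∈ F₁ := ⟨1, ⟨1, h1A, 1, h1, by simp⟩, 1, by simpa using h1A, by simp⟩
  obtain ⟨β, hβ⟩ := hBne
  have hβA₂ : β ∈ A₂ := Or.inl hβ
  have h1L : (1 : G) ∈ L := by simpa using memL hβA₂ h1 hβA₂
  have hLF : L ⊆ F₂ := fun x hx => by simpa using Set.mul_mem_mul hx h1L
  have hF₁f : F₁.Finite := (hA.mul hD).mul hA.inv
  have hF₂f : F₂.Finite := ((hA₂f.mul hD).mul hA₂f.inv).mul ((hA₂f.mul hD).mul hA₂f.inv)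
  have hS₁ := isGluingShift_separatedSyndetic hF₁f h1F₁ hF₁i
  have hS₂ := isGluingShift_separatedSyndetic hF₂f (hLF h1L) hF₂i
  have hS := isGluingShift_image_markerSet (Q := F₁ ^ 3 ∪ F₂ ^ 3) hD hA hA₂f
    (Or.inl (Set.one_mem_pow h1F₁)) (hS₁.mono Set.subset_union_left)
    (hS₂.mono Set.subset_union_right)
  have sep₁ {m : G → Bool} (hm : m ∈ separatedSyndetic F₁) {x z : G} (hx : m x = true)
      (hz : m z = true) (h : x⁻¹ * z ∈ F₁) : x = z :=
    inv_mul_eq_one.1 ((hm x).1 hx _ h (by rwa [mul_inv_cancel_left]))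
  have sep₂ {m : G → Bool} (hm : m ∈ separatedSyndetic F₂) {x z : G} (hx : m x = true)
      (hz : m z = true) (h : x⁻¹ * z ∈ F₂) : x = z :=
    inv_mul_eq_one.1 ((hm x).1 hx _ h (by rwa [mul_inv_cancel_left]))
  refine ⟨_, _, ?_, ?_, hS, ?_, ?_⟩
  · have hR : (A₂⁻¹ ∪ A⁻¹ ∪ D * A₂⁻¹).Finite := (hA₂f.inv.union hA.inv).union (hD.mul hA₂f.inv)
    exact (hR.mul ((hF₁f.group_pow 3).union (hF₂f.group_pow 3))).mul hR.inv
  · have h1R : (1 : G) ∈ A₂⁻¹ ∪ A⁻¹ ∪ D * A₂⁻¹ := Or.inl (Or.inr (by simpa using h1A))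
    have h1Q : (1 : G) ∈ F₁ ^ 3 ∪ F₂ ^ 3 := Or.inl (Set.one_mem_pow h1F₁)
    have := Set.mul_mem_mul (Set.mul_mem_mul h1R h1Q) (Set.inv_mem_inv.2 h1R)
    simpa using this
  · rintro _ ⟨⟨m₁, m₂⟩, ⟨hm₁, hm₂⟩, rfl⟩ x hx z hz h
    rcases markerSet_eq_true.1 hx with ⟨a, ha, hxa⟩ | ⟨⟨a, ha, hxa⟩, hx'⟩ <;>
    rcases markerSet_eq_true.1 hz with ⟨b, hb, hzb⟩ | ⟨⟨b, hb, hzb⟩, hz'⟩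
    · have e : x * a⁻¹ = z * b⁻¹ := sep₂ hm₂ hxa hzb (hLF (by
        have := memL ha h hb
        convert this using 1; group))
      have e' : a⁻¹ * b = x⁻¹ * z := by
        have hz : z = x * a⁻¹ * b := by rw [e]; group
        rw [hz]; group
      have hab := hA₂s a ha b hb (e' ▸ h)
      rw [← inv_mul_eq_one, ← e', hab, inv_mul_cancel]
    · refine absurd hxa ?_
      have := hz' a ha _ (dinv h)
      convert this using 3; group
    · refine absurd hzb ?_
      have := hx' b hb _ h
      convert this using 3; group
    · have e : x * a⁻¹ = z * b⁻¹ := sep₁ hm₁ hxa hzb (by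
        have := Set.mul_mem_mul (Set.mul_mem_mul ha h) (Set.inv_mem_inv.2 hb)
        convert this using 1; group)
      have e' : a⁻¹ * b = x⁻¹ * z := by
        have hz : z = x * a⁻¹ * b := by rw [e]; group
        rw [hz]; group
      have hab := hAs a ha b hb (e' ▸ h)
      rw [← inv_mul_eq_one, ← e', hab, inv_mul_cancel]
  · rintro _ ⟨⟨m₁, m₂⟩, ⟨hm₁, hm₂⟩, rfl⟩ _ ⟨⟨n₁, n₂⟩, ⟨hn₁, hn₂⟩, rfl⟩
    obtain ⟨f, -, hf⟩ := (hm₂ 1).2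
    set c : G := 1 * f
    by_contra! hno
    -- a translate of `B` inside `c * A₂` meets the second set unless it is blocked
    have blocked : ∀ s : G, (∀ b ∈ B, s * b ∈ A₂) → ∃ b ∈ B, ∃ d ∈ D, ∃ α ∈ A₂,
        n₂ (c * s * b * d * α⁻¹) = true ∧ ∀ b' ∈ A₂, ¬ n₂ (c * s * b * b'⁻¹) = true := by
      intro s hs
      obtain ⟨_, ⟨_, ⟨a, ha, d, hd, rfl⟩, a', ha', rfl⟩, hg⟩ := (hn₁ (c * s)).2
      obtain ⟨z, hz, hzB⟩ := hAB a ha d hd _ ha'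
      simp only [inv_inv] at hzB
      have hin : markerSet D A A₂ (m₁, m₂) (c * s * (a * d * a' * z)) = true := by
        refine markerSet_eq_true.2 (Or.inl ⟨_, hs _ hzB, ?_⟩)
        convert hf using 2; group
      have hout := hno _ hin
      rw [Ne, markerSet_eq_true, not_or, not_and] at hout
      obtain ⟨h₁, h₂⟩ := hout
      have h₃ := h₂ ⟨z, hz, by convert hg using 2; group⟩
      push Not at h₁ h₃
      obtain ⟨α, hα, e, he, hn⟩ := h₃
      exact ⟨_, hzB, e, he, α, hα, hn, h₁⟩
    obtain ⟨b, hb, d, hd, α, hα, hn, hnb⟩ := blocked 1 (fun b hb => Or.inl (by simpa using hb))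
    obtain ⟨b', hb', d', hd', α', hα', hn', -⟩ := blocked t
      (fun b hb => Or.inr ⟨t, rfl, b, hb, rfl⟩)
    have htb' : t * b' ∈ A₂ := Or.inr ⟨t, rfl, b', hb', rfl⟩
    have e : c * 1 * b * d * α⁻¹ = c * t * b' * d' * α'⁻¹ := by
      refine sep₂ hn₂ hn hn' ?_
      have := Set.mul_mem_mul (memL hα (dinv hd) (Or.inl hb : b ∈ A₂)) (memL htb' hd' hα')
      convert this using 1; group
    have e₁ : b * d * α⁻¹ = t * (b' * d' * α'⁻¹) := by
      simpa only [mul_one, mul_assoc, mul_right_inj] using e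
    have hne : b * d * α⁻¹ ≠ 1 := by
      intro h
      refine hnb b (Or.inl hb) ?_
      have h2 : c * 1 * b * d * α⁻¹ = c := by
        have : c * 1 * b * d * α⁻¹ = c * (b * d * α⁻¹) := by group
        rw [this, h, mul_one]
      rw [h2] at hn
      convert hn using 2; group
    rcases memA₂ α hα with hα | ⟨α, hαB, rfl⟩ <;> rcases memA₂ α' hα' with hα' | ⟨α', hαB', rfl⟩
    · refine ht.ne _ (Or.inr (Set.mul_mem_mul (memH hb hd hα)
        (Set.inv_mem_inv.2 (memH hb' hd' hα')))) ?_
      rw [e₁]; group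
    · refine ht.conj_ne _ (Or.inl (memH hb hd hα)) _ (Or.inl (memH hb' hd' hαB')) hne ?_
      rw [e₁]; group
    · refine ht.square_ne _ (Or.inl (memH hb' hd' hα')) _ (Or.inl (memH hb hd hαB)) ?_
      rw [← e₁]; group
    · refine ht.ne _ (Or.inr (Set.mul_mem_mul (memH hb hd hαB)
        (Set.inv_mem_inv.2 (memH hb' hd' hαB')))) ?_
      have e₂ : b * d * α⁻¹ = t * (b' * d' * α'⁻¹) := by
        have : b * d * α⁻¹ = b * d * (t * α)⁻¹ * t := by group
        rw [this, e₁]; group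
      rw [e₂]; group

end Markers

section Synchronization

open Pointwise

variable {G : Type*} [Group G]

/-- In an ICC group every gluing shift contains a smaller one in which any two configurations agree
on some translate of the finite window `W`. -/
theorem IsGluingShift.exists_synchronized (hG : IsICC G) {Q₀ : Set G} (hQ₀ : Q₀.Finite)
    {S : Set (G → Bool)} (hS₀ : IsGluingShift Q₀ S) {W : Set G} (hW : W.Finite) :
    ∃ (Q' : Set G) (S' : Set (G → Bool)), Q'.Finite ∧ S' ⊆ S ∧ IsGluingShift Q' S' ∧
      ∀ x ∈ S', ∀ y ∈ S', ∃ g, ∀ w ∈ W, x (g * w) = y (g * w) := by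
  classical
  obtain ⟨Q, hQsub, hQ, h1, hQi⟩ := (hQ₀.union hW).exists_symm_superset
  have hS : IsGluingShift Q S := hS₀.mono (Set.subset_union_left.trans hQsub)
  obtain ⟨QK, K, hQK, h1K, hK, hKsep, hKmeet⟩ := hG.exists_markers_s3 (hQ.group_pow 3)
    (Set.one_mem_pow h1) (by rw [← inv_pow, hQi])
  obtain ⟨p, hp⟩ := hS.nonempty
  have tmul {m n : ℕ} {x y : G} : x ∈ Q ^ m → y ∈ Q ^ n → x * y ∈ Q ^ (m + n) :=
    Set.mul_mem_pow_add
  have tinv {m : ℕ} {x : G} : x ∈ Q ^ m → x⁻¹ ∈ Q ^ m := Set.inv_mem_pow hQi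
  have up {m n : ℕ} {x : G} (hx : x ∈ Q ^ m) (hm : m ≤ n) : x ∈ Q ^ n :=
    Set.mem_pow_of_mem_of_le h1 hx hm
  have t1 {x : G} (hx : x ∈ Q) : x ∈ Q ^ 1 := by rwa [pow_one]
  refine ⟨Q ^ 4 * QK * (Q ^ 4)⁻¹ ∪ Q ^ 7,
    {x | x ∈ S ∧ ∃ C ∈ K, ∀ c, C c = true → ∀ w ∈ Q, x (c * w) = p w}, ?_, fun x hx => hx.1,
    ⟨?_, ?_, ?_⟩, ?_⟩
  · exact (((hQ.group_pow 4).mul hQK).mul (hQ.group_pow 4).inv).union (hQ.group_pow 7)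
  · have : {x | x ∈ S ∧ ∃ C ∈ K, ∀ c, C c = true → ∀ w ∈ Q, x (c * w) = p w} =
        Prod.fst '' ((S ×ˢ K) ∩ ⋂ c, ⋂ w ∈ Q,
          ({q : (G → Bool) × (G → Bool) | q.2 c = false} ∪ {q | q.1 (c * w) = p w})) := by
      ext x
      simp only [Set.mem_ofPred_eq, Set.mem_image, Set.mem_inter_iff, Set.mem_prod, Set.mem_iInter,
        Set.mem_union, Prod.exists, exists_and_right, exists_eq_right]
      constructor
      · rintro ⟨hx, C, hC, h⟩
        refine ⟨C, ⟨hx, hC⟩, fun c w hw => ?_⟩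
        cases hc : C c with
        | false => exact Or.inl rfl
        | true => exact Or.inr (h c hc w hw)
      · rintro ⟨C, ⟨hx, hC⟩, h⟩
        refine ⟨hx, C, hC, fun c hc w hw => (h c w hw).resolve_left (by simp [hc])⟩
    rw [this]
    refine (IsCompact.image (IsClosed.isCompact ?_) continuous_fst).isClosed
    refine (hS.isClosed.prod hK.isClosed).inter
      (isClosed_iInter fun c => isClosed_biInter fun w _ => IsClosed.union ?_ ?_)
    · exact isClosed_eq ((continuous_apply c).comp continuous_snd) continuous_const
    · exact isClosed_eq ((continuous_apply _).comp continuous_fst) continuous_const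
  · rintro x ⟨hx, C, hC, h⟩ g
    refine ⟨hS.shift_mem x hx g, _, hK.shift_mem C hC g, fun c hc w hw => ?_⟩
    simpa only [mul_assoc] using h _ hc w hw
  · intro E y hy hyE
    have hex : ∀ g ∈ E, ∃ C ∈ K, ∀ c, C c = true → ∀ w ∈ Q, y g (c * w) = p w :=
      fun g hg => (hy g hg).2
    have hex' : ∃ C : (G → Bool) → (G → Bool), ∀ g ∈ E, C (y g) ∈ K ∧
        ∀ c, C (y g) c = true → ∀ w ∈ Q, y g (c * w) = p w := by
      refine ⟨fun x => if h : ∃ C ∈ K, ∀ c, C c = true → ∀ w ∈ Q, x (c * w) = p w then h.choose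
        else x, fun g hg => ?_⟩
      simp only [dif_pos (hex g hg)]
      exact (hex g hg).choose_spec
    obtain ⟨C, hC⟩ := hex'
    obtain ⟨C', hC'K, hC'⟩ := hK.exists_glue_mul (R := Q ^ 4) h1K E (fun g => C (y g))
      (fun g hg => (hC g hg).1)
      (fun g hg h hh hgh => congrArg C (hyE g hg h hh (Or.inl hgh)))
    have sep {c c' : G} (hc : C' c = true) (hc' : C' c' = true) (h : c⁻¹ * c' ∈ Q ^ 3) : c = c' :=
      hKsep C' hC'K c hc c' hc' h
    have hyE7 {m : ℕ} (hm : m ≤ 7) {g h : G} (hg : g ∈ E) (hh : h ∈ E) (hgh : g⁻¹ * h ∈ Q ^ m) :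
        y g = y h := hyE g hg h hh (Or.inr (up hgh hm))
    let near : G → Prop := fun e =>
      e ∈ E ∨ ∃ c, C' c = true ∧ c⁻¹ * e ∈ Q ∧ ∃ g ∈ E, g⁻¹ * c ∈ Q ^ 2
    have hnear : ∀ e, near e → ∃ g ∈ E, g⁻¹ * e ∈ Q ^ 3 := by
      rintro e (he | ⟨c, -, hce, g, hg, hgc⟩)
      · exact ⟨e, he, by rw [inv_mul_cancel]; exact Set.one_mem_pow h1⟩
      · refine ⟨g, hg, ?_⟩
        have := tmul hgc (t1 hce)
        rwa [mul_assoc, mul_inv_cancel_left] at this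
    set E' : Set G := E ∪ {e | ∃ c, C' c = true ∧ c⁻¹ * e ∈ Q} with hE'
    have hfar : ∀ e, e ∈ E' → ¬ near e → ∃ c, C' c = true ∧ c⁻¹ * e ∈ Q ∧
        ∀ g ∈ E, g⁻¹ * c ∉ Q ^ 2 := by
      rintro e (he | ⟨c, hc, hce⟩) hn
      · exact absurd (Or.inl he) hn
      · exact ⟨c, hc, hce, fun g hg hgc => hn (Or.inr ⟨c, hc, hce, g, hg, hgc⟩)⟩
    choose! γ hγE hγ using hnear
    choose! κ hκC hκ hκE using hfar
    have nearfar {e e' : G} (hn : near e) (he' : e' ∈ E') (hn' : ¬ near e')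
        (h : e⁻¹ * e' ∈ Q ^ 1) : False := by
      have hκ' := tinv (t1 (hκ e' he' hn'))
      rcases hn with he | ⟨c, hc, hce, g, hg, hgc⟩
      · refine hκE e' he' hn' e he ?_
        have := tmul h hκ'
        convert this using 1; group
      · have : c = κ e' := by
          refine sep hc (hκC e' he' hn') ?_
          have := tmul (tmul (t1 hce) h) hκ'
          convert this using 1; group
        exact hκE e' he' hn' g hg (this ▸ hgc)
    obtain ⟨z, hzS, hz⟩ := hS.exists_glue E'
      (fun e => if near e then y (γ e) else fun h => p ((κ e)⁻¹ * h))
      (by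
        intro e he
        by_cases hn : near e
        · simp only [if_pos hn]
          exact (hy _ (hγE e hn)).1
        · simp only [if_neg hn]
          exact hS.shift_mem p hp _)
      (by
        intro e he e' he' h
        have h := t1 h
        by_cases hn : near e <;> by_cases hn' : near e'
        · simp only [if_pos hn, if_pos hn']
          refine hyE7 le_rfl (hγE e hn) (hγE e' hn') ?_
          have := tmul (tmul (hγ e hn) h) (tinv (hγ e' hn'))
          convert this using 1; group
        · exact (nearfar hn he' hn' h).elim
        · refine (nearfar hn' he hn ?_).elim
          have := tinv h
          rwa [mul_inv_rev, inv_inv] at this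
        · simp only [if_neg hn, if_neg hn']
          have : κ e = κ e' := by
            refine sep (hκC e he hn) (hκC e' he' hn') ?_
            have := tmul (tmul (t1 (hκ e he hn)) h) (tinv (t1 (hκ e' he' hn')))
            convert this using 1; group
          rw [this])
    refine ⟨z, ⟨hzS, C', hC'K, fun c hc w hw => ?_⟩, fun e he => ?_⟩
    · have hcw : c⁻¹ * (c * w) ∈ Q := by rwa [inv_mul_cancel_left]
      have he : c * w ∈ E' := Or.inr ⟨c, hc, hcw⟩
      rw [hz _ he]
      by_cases hn : near (c * w)
      · simp only [if_pos hn]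
        have hg := hγE _ hn
        refine (hC _ hg).2 c ?_ w hw
        have hgc : (γ (c * w))⁻¹ * c ∈ Q ^ 4 := by
          have := tmul (hγ _ hn) (tinv (t1 hw))
          convert this using 1; group
        have := hC' _ hg _ hgc
        rw [mul_inv_cancel_left, hc] at this
        exact this.symm
      · simp only [if_neg hn]
        have : κ (c * w) = c := by
          refine sep (hκC _ he hn) hc (up (m := 2) ?_ (by norm_num))
          have := tmul (t1 (hκ _ he hn)) (tinv (t1 hw))
          convert this using 1; group
        rw [this, inv_mul_cancel_left]
    · have hn : near e := Or.inl he
      rw [hz e (Or.inl he)]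
      simp only [if_pos hn]
      rw [hyE7 (m := 3) (by norm_num) (hγE e hn) he (hγ e hn)]
  · rintro x ⟨-, C, hC, hx⟩ y ⟨-, C', hC', hy⟩
    obtain ⟨c, hc, hc'⟩ := hKmeet C hC C' hC'
    refine ⟨c, fun w hw => ?_⟩
    have hwQ : w ∈ Q := hQsub (Or.inr hw)
    rw [hx c hc w hwQ, hy c hc' w hwQ]

end Synchronization

section ShiftAction

variable {G : Type*} [Group G]

/-- A countable ICC group has a closed shift-invariant set without constant configurations, in
which any two configurations agree on translates of all finite windows. -/
theorem IsICC.exists_synchronized_shift [Countable G] (hG : IsICC G) :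
    ∃ S : Set (G → Bool), S.Nonempty ∧ IsClosed S ∧
      (∀ x ∈ S, ∀ g : G, (fun h => x (g * h)) ∈ S) ∧ (∀ x ∈ S, ∃ g h, x g ≠ x h) ∧
      ∀ W : Set G, W.Finite → ∀ x ∈ S, ∀ y ∈ S, ∃ g, ∀ w ∈ W, x (g * w) = y (g * w) := by
  have := hG.1
  obtain ⟨t, ht⟩ := exists_ne (1 : G)
  obtain ⟨F, htF, hF, h1, hFi⟩ := (Set.finite_singleton t).exists_symm_superset
  obtain ⟨e, he⟩ := exists_surjective_nat (Finset G)
  let T := {S : Set (G → Bool) // ∃ Q : Set G, Q.Finite ∧ IsGluingShift Q S}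
  have hstep : ∀ (n : ℕ) (S : T), ∃ S' : T, S'.1 ⊆ S.1 ∧
      ∀ x ∈ S'.1, ∀ y ∈ S'.1, ∃ g, ∀ w ∈ e n, x (g * w) = y (g * w) := by
    rintro n ⟨S, Q, hQ, hS⟩
    obtain ⟨Q', S', hQ', hsub, hS', h⟩ := hS.exists_synchronized hG hQ (e n).finite_toSet
    exact ⟨⟨S', Q', hQ', hS'⟩, hsub, h⟩
  choose f hfsub hf using hstep
  let s : ℕ → T := fun n => Nat.rec ⟨separatedSyndetic F, _, hF.group_pow 3,
    isGluingShift_separatedSyndetic hF h1 hFi⟩ f n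
  have hclosed (n : ℕ) : IsClosed (s n).1 := by
    obtain ⟨Q, -, hQ⟩ := (s n).2
    exact hQ.isClosed
  refine ⟨⋂ n, (s n).1, ?_, isClosed_iInter hclosed, ?_, ?_, ?_⟩
  · refine IsCompact.nonempty_iInter_of_sequence_nonempty_isCompact_isClosed _
      (fun n => hfsub n (s n)) (fun n => ?_) (hclosed 0).isCompact hclosed
    obtain ⟨Q, -, hQ⟩ := (s n).2
    exact hQ.nonempty
  · intro x hx g
    refine Set.mem_iInter.2 fun n => ?_
    obtain ⟨Q, -, hQ⟩ := (s n).2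
    exact hQ.shift_mem x (Set.mem_iInter.1 hx n) g
  · intro x hx
    by_contra! hcon
    have h0 : x ∈ separatedSyndetic F := Set.mem_iInter.1 hx 0
    obtain ⟨a, -, ha⟩ := (h0 1).2
    have hx' (g : G) : x g = true := (hcon g _).trans ha
    exact ht ((h0 1).1 (hx' _) t (htF rfl) (hx' _))
  · intro W hW x hx y hy
    obtain ⟨n, hn⟩ := he hW.toFinset
    obtain ⟨g, hg⟩ := hf n (s n) x (Set.mem_iInter.1 hx (n + 1)) y (Set.mem_iInter.1 hy (n + 1))
    exact ⟨g, fun w hw => hg w (by simpa [hn] using hw)⟩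

/-- The left translation action on a shift-invariant set of configurations. -/
abbrev shiftAction (S : Set (G → Bool)) (hS : ∀ x ∈ S, ∀ g : G, (fun h => x (g * h)) ∈ S) :
    MulAction G S where
  smul g x := ⟨fun h => x.1 (g⁻¹ * h), hS x.1 x.2 g⁻¹⟩
  one_smul x := Subtype.ext (funext fun h => congrArg x.1 (by group))
  mul_smul g k x := Subtype.ext (funext fun h => congrArg x.1 (by group))

end ShiftAction

/-- A countable ICC group has a proximal action on a compact Hausdorff space without fixed
points. -/
theorem IsICC.exists_isProximalAction {G : Type} [Group G] [Countable G] (hG : IsICC G) :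
    ∃ (X : Type) (_ : TopologicalSpace X) (_ : MulAction G X),
      CompactSpace X ∧ T2Space X ∧ Nonempty X ∧ ContinuousConstSMul G X ∧
      IsProximalAction G X ∧ ¬ ∃ z : X, ∀ g : G, g • z = z := by
  obtain ⟨S, hne, hclosed, hshift, hconst, hsync⟩ := hG.exists_synchronized_shift
  let act := shiftAction S hshift
  have smul_apply (g : G) (x : S) (h : G) : (g • x).1 h = x.1 (g⁻¹ * h) := rfl
  have hcompact : CompactSpace S := isCompact_iff_compactSpace.1 hclosed.isCompact
  have heval (h : G) : Continuous fun x : S => x.1 h :=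
    (continuous_apply h).comp continuous_subtype_val
  refine ⟨S, inferInstance, act, inferInstance, inferInstance, hne.to_subtype,
    ⟨fun g => ?_⟩, fun x y => ?_, ?_⟩
  · exact Continuous.subtype_mk (continuous_pi fun h => heval _) _
  · have hne : (closure {p : S × S | ∃ g : G, p = (g • x, g • y)} ∩
        ⋂ h : G, {p : S × S | p.1.1 h = p.2.1 h}).Nonempty := by
      refine isClosed_closure.isCompact.inter_iInter_nonempty _ (fun h => ?_) fun u => ?_
      · exact isClosed_eq ((heval h).comp continuous_fst) ((heval h).comp continuous_snd)
      · obtain ⟨g, hg⟩ := hsync _ u.finite_toSet x.1 x.2 y.1 y.2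
        refine ⟨(g⁻¹ • x, g⁻¹ • y), subset_closure ⟨g⁻¹, rfl⟩, Set.mem_iInter₂.2 fun h hh => ?_⟩
        simpa only [Set.mem_ofPred_eq, smul_apply, inv_inv] using hg h hh
    obtain ⟨⟨u, v⟩, huv, h⟩ := hne
    have : u = v := Subtype.ext (funext fun g => Set.mem_iInter.1 h g)
    subst this
    exact ⟨u, huv⟩
  · rintro ⟨z, hz⟩
    obtain ⟨g, h, hgh⟩ := hconst z.1 z.2
    refine hgh ?_
    have key (k : G) : z.1 k = z.1 1 := by
      conv_lhs => rw [← hz k]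
      rw [smul_apply, inv_mul_cancel]
    rw [key g, key h]

/-- If a countable discrete group `G` has an ICC quotient, then `G` is not strongly amenable:
there is a proximal continuous action of `G` on a nonempty compact Hausdorff space that
has no fixed point. -/
theorem not_stronglyAmenable_of_icc_quotient (G : Type) [Group G] [Countable G]
    (N : Subgroup G) [N.Normal] (hICC : IsICC (G ⧸ N)) :
    ∃ (X : Type) (_ : TopologicalSpace X) (_ : MulAction G X),
      CompactSpace X ∧ T2Space X ∧ Nonempty X ∧ ContinuousConstSMul G X ∧
      IsProximalAction G X ∧ ¬ ∃ z : X, ∀ g : G, g • z = z := by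
  have : Countable (G ⧸ N) := QuotientGroup.mk_surjective.countable
  obtain ⟨X, _, _, hcomp, hT2, hne, hcont, hprox, hfix⟩ := hICC.exists_isProximalAction
  let act := MulAction.compHom X (QuotientGroup.mk' N)
  refine ⟨X, inferInstance, act, hcomp, hT2, hne, ⟨fun g => ?_⟩, fun x y => ?_, ?_⟩
  · exact continuous_const_smul (g : G ⧸ N)
  · obtain ⟨z, hz⟩ := hprox x y
    refine ⟨z, closure_mono ?_ hz⟩
    rintro _ ⟨q, rfl⟩
    obtain ⟨g, rfl⟩ := QuotientGroup.mk_surjective q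
    exact ⟨g, rfl⟩
  · rintro ⟨z, hz⟩
    refine hfix ⟨z, fun q => ?_⟩
    obtain ⟨g, rfl⟩ := QuotientGroup.mk_surjective q
    exact hz g
end
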